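/- arXiv:2206.01152 — 3 statements merged into one kernel-verified Lean document; each statement's English description precedes it below -/
import Mathlib

section
/- Two DAGs G and G' on Fin p are Markov equivalent if and only if their standard imsets are equal, i.e., u_G = u_{G'}. -/
namespace CausalDiscovery

variable {V : Type*}

/-- A relation is acyclic if it has no directed cycles. -/
def Acyclic (E : V → V → Prop) : Prop :=
  ∀ v, ¬ Relation.TransGen E v v

/-- `i` and `j` are adjacent (joined by an edge in either direction). -/
def Adj (E : V → V → Prop) (i j : V) : Prop :=
  E i j ∨ E j i

/-- `j` is a descendant of `i`, i.e. reachable from `i` by a directed path. -/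
def Desc (E : V → V → Prop) (i j : V) : Prop :=
  Relation.ReflTransGen E i j

/-- `f 0, f 1, …, f n` is a path between `i` and `j`: the vertices are distinct and
consecutive vertices are adjacent. -/
def IsPath (E : V → V → Prop) (n : ℕ) (f : ℕ → V) (i j : V) : Prop :=
  0 < n ∧ f 0 = i ∧ f n = j ∧
    (∀ s t, s ≤ n → t ≤ n → f s = f t → s = t) ∧
    ∀ t, t < n → Adj E (f t) (f (t + 1))

/-- The vertex at (interior) position `t` of the path `f` is a collider:
both edges of the path at that vertex point into it. -/
def ColliderAt (E : V → V → Prop) (f : ℕ → V) (t : ℕ) : Prop :=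
  E (f (t - 1)) (f t) ∧ E (f (t + 1)) (f t)

/-- The path `f 0, …, f n` d-connects its endpoints given `C`: every non-collider
interior vertex is outside `C`, every collider is in `C` or has a descendant in `C`. -/
def DConn (E : V → V → Prop) (n : ℕ) (f : ℕ → V) (C : Finset V) : Prop :=
  ∀ t, 0 < t → t < n →
    (ColliderAt E f t → f t ∈ C ∨ ∃ d ∈ C, Desc E (f t) d) ∧
    (¬ ColliderAt E f t → f t ∉ C)

/-- `i` and `j` are d-separated given `C`: no path between them d-connects given `C`. -/
def DSep (E : V → V → Prop) (i j : V) (C : Finset V) : Prop :=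
  ∀ n f, IsPath E n f i j → ¬ DConn E n f C

/-- The independence model `I(E)`: all d-separation triples `(i, j, C)` with `i, j`
distinct and `C ⊆ V \ {i, j}`. -/
def Indep (E : V → V → Prop) : Set (V × V × Finset V) :=
  {x | x.1 ≠ x.2.1 ∧ x.1 ∉ x.2.2 ∧ x.2.1 ∉ x.2.2 ∧ DSep E x.1 x.2.1 x.2.2}

/-- Two graphs are Markov equivalent if they have the same independence model. -/
def MarkovEquiv (E E' : V → V → Prop) : Prop :=
  Indep E = Indep E'

/-- Two graphs have the same skeleton if they have the same adjacencies. -/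
def SameSkeleton (E E' : V → V → Prop) : Prop :=
  ∀ i j, Adj E i j ↔ Adj E' i j

/-- The v-structures of a graph: triples `(i, j, k)` with `i → j ← k` and `i, k`
not adjacent. -/
def VStruct (E : V → V → Prop) : Set (V × V × V) :=
  {x | E x.1 x.2.1 ∧ E x.2.2 x.2.1 ∧ x.1 ≠ x.2.2 ∧ ¬ Adj E x.1 x.2.2}


/-- The standard basis vector `δ_A` of `ℤ^(Finset (Fin p))`. -/
def delta {p : ℕ} (A : Finset (Fin p)) : Finset (Fin p) → ℤ :=
  fun B => if B = A then 1 else 0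

open Classical in
/-- The parent set `pa(j) = {i : i → j}` as a `Finset`. -/
noncomputable def parents {p : ℕ} (E : Fin p → Fin p → Prop) (j : Fin p) :
    Finset (Fin p) :=
  Finset.univ.filter fun i => E i j

/-- The standard imset of a DAG:
`u_G = δ_{[p]} − δ_∅ + Σ_i (δ_{pa(i)} − δ_{{i} ∪ pa(i)})`. -/
noncomputable def standardImset {p : ℕ} (E : Fin p → Fin p → Prop) :
    Finset (Fin p) → ℤ :=
  fun B =>
    delta Finset.univ B - delta ∅ B +
      ∑ i : Fin p, (delta (parents E i) B - delta (insert i (parents E i)) B)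

section Walks

/-- The vertex `b` has a descendant in `C` (possibly `b` itself). -/
def HasDescIn (E : V → V → Prop) (C : Finset V) (b : V) : Prop :=
  ∃ d ∈ C, Desc E b d

/-- Passing from `a` through `b` to `c` is not blocked by `C`. -/
def Passable (E : V → V → Prop) (C : Finset V) (a b c : V) : Prop :=
  (E a b ∧ E c b → HasDescIn E C b) ∧ (¬ (E a b ∧ E c b) → b ∉ C)

/-- `f 0, …, f n` is a walk, possibly with repeated vertices, that is not blocked by `C`. -/
def ActiveWalk (E : V → V → Prop) (C : Finset V) (n : ℕ) (f : ℕ → V) : Prop :=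
  (∀ t, t < n → Adj E (f t) (f (t + 1))) ∧
    ∀ t, t + 1 < n → Passable E C (f t) (f (t + 1)) (f (t + 2))

/-- An active walk that is shortest among the active walks with the same endpoints. -/
def ShortestWalk (E : V → V → Prop) (C : Finset V) (n : ℕ) (f : ℕ → V) : Prop :=
  ActiveWalk E C n f ∧
    ∀ m g, ActiveWalk E C m g → g 0 = f 0 → g m = f n → n ≤ m

variable {E : V → V → Prop} {C : Finset V} {n : ℕ} {f : ℕ → V}

theorem Adj.symm {a b : V} (h : Adj E a b) : Adj E b a := Or.symm h

theorem Passable.symm {a b c : V} (h : Passable E C a b c) : Passable E C c b a :=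
  ⟨fun h' => h.1 h'.symm, fun h' => h.2 fun h'' => h' h''.symm⟩

theorem HasDescIn.of_mem {b : V} (h : b ∈ C) : HasDescIn E C b :=
  ⟨b, h, Relation.ReflTransGen.refl⟩

theorem HasDescIn.of_desc {a b : V} (h : HasDescIn E C b) (hab : Desc E a b) :
    HasDescIn E C a := by
  obtain ⟨d, hd, hbd⟩ := h
  exact ⟨d, hd, Relation.ReflTransGen.trans hab hbd⟩

theorem Acyclic.irrefl (hE : Acyclic E) {a : V} : ¬ E a a :=
  fun h => hE a (.single h)

theorem Acyclic.asymm (hE : Acyclic E) {a b : V} (h : E a b) : ¬ E b a :=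
  fun h' => hE a (.tail (.single h) h')

theorem Acyclic.of_adj_of_path (hE : Acyclic E) {a b c : V} (hab : E a b) (hbc : E b c)
    (hac : Adj E a c) : E a c :=
  hac.resolve_right fun h => hE a (.tail (.tail (.single hab) hbc) h)

theorem ActiveWalk.reverse (h : ActiveWalk E C n f) :
    ActiveWalk E C n fun s => f (n - s) := by
  refine ⟨fun t ht => ?_, fun t ht => ?_⟩
  · have := (h.1 (n - (t + 1)) (by omega)).symm
    rwa [show n - (t + 1) + 1 = n - t by omega] at this
  · have := (h.2 (n - (t + 2)) (by omega)).symm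
    rwa [show n - (t + 2) + 1 = n - (t + 1) by omega,
      show n - (t + 2) + 2 = n - t by omega] at this

theorem ShortestWalk.reverse (h : ShortestWalk E C n f) :
    ShortestWalk E C n fun s => f (n - s) := by
  refine ⟨h.1.reverse, fun m g hg h0 hm => h.2 m _ hg.reverse ?_ ?_⟩
  · simpa using hm
  · simpa using h0

theorem ActiveWalk.exists_shortest (h : ActiveWalk E C n f) :
    ∃ m g, ShortestWalk E C m g ∧ g 0 = f 0 ∧ g m = f n := by
  classical
  have hex : ∃ m, ∃ g, ActiveWalk E C m g ∧ g 0 = f 0 ∧ g m = f n := ⟨n, f, h, rfl, rfl⟩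
  obtain ⟨g, hg, h0, hm⟩ := Nat.find_spec hex
  refine ⟨Nat.find hex, g, ⟨hg, fun m g' hg' h0' hm' => ?_⟩, h0, hm⟩
  exact Nat.find_min' hex ⟨g', hg', h0'.trans h0, hm'.trans hm⟩

/-- Cutting the `k` vertices after position `t` out of a walk. -/
theorem ActiveWalk.cut (h : ActiveWalk E C n f) {t k : ℕ} (hk : t + k < n)
    (hadj : Adj E (f t) (f (t + k + 1)))
    (hleft : 0 < t → Passable E C (f (t - 1)) (f t) (f (t + k + 1)))
    (hright : t + k + 1 < n → Passable E C (f t) (f (t + k + 1)) (f (t + k + 2))) :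
    ActiveWalk E C (n - k) fun s => if s ≤ t then f s else f (s + k) := by
  refine ⟨fun s hs => ?_, fun s hs => ?_⟩
  · rcases lt_trichotomy s t with hst | rfl | hst
    · simpa [hst.le, show s + 1 ≤ t by omega] using h.1 s (by omega)
    · simpa [add_right_comm] using hadj
    · simpa [hst.not_ge, show ¬ s + 1 ≤ t by omega, add_right_comm] using h.1 (s + k) (by omega)
  · rcases lt_trichotomy (s + 1) t with hst | rfl | hst
    · simpa [hst.le, show s ≤ t by omega, show s + 2 ≤ t by omega] using h.2 s (by omega)
    · simpa [add_right_comm, add_assoc, add_comm, add_left_comm] using hleft (by omega)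
    · rcases (show s = t ∨ t < s by omega) with rfl | hst'
      · simpa [add_right_comm] using hright (by omega)
      · simpa [hst.not_ge, hst'.not_ge, show ¬ s + 2 ≤ t by omega, add_right_comm]
          using h.2 (s + k) (by omega)

theorem ShortestWalk.not_cut (h : ShortestWalk E C n f) {t k : ℕ} (hpos : 0 < k) (hk : t + k < n)
    (hadj : Adj E (f t) (f (t + k + 1)))
    (hleft : 0 < t → Passable E C (f (t - 1)) (f t) (f (t + k + 1)))
    (hright : t + k + 1 < n → Passable E C (f t) (f (t + k + 1)) (f (t + k + 2))) :
    False := by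
  have := h.2 _ _ (h.1.cut hk hadj hleft hright) (by simp)
    (by simp [show ¬ n - k ≤ t by omega, show n - k + k = n by omega])
  omega

/-- A walk leaving `f s` along an outgoing edge keeps going forward until it meets a collider. -/
theorem ActiveWalk.follow (h : ActiveWalk E C n f) {s : ℕ} (hs : E (f s) (f (s + 1))) (r : ℕ)
    (hr : s + r + 1 ≤ n) :
    HasDescIn E C (f s) ∨
      (Relation.TransGen E (f s) (f (s + r + 1)) ∧ E (f (s + r)) (f (s + r + 1))) := by
  induction r with
  | zero => exact Or.inr ⟨.single hs, hs⟩
  | succ r ih =>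
    refine (ih (by omega)).elim Or.inl fun ⟨hreach, hin⟩ => ?_
    have hpass := h.2 (s + r) (by omega)
    rcases h.1 (s + r + 1) (by omega) with hout | hback
    · exact Or.inr ⟨hreach.tail hout, hout⟩
    · exact Or.inl ((hpass.1 ⟨hin, hback⟩).of_desc hreach.to_reflTransGen)

theorem ShortestWalk.injective (hE : Acyclic E) (h : ShortestWalk E C n f) {s t : ℕ}
    (hst : s < t) (ht : t ≤ n) : f s ≠ f t := by
  intro heq
  obtain ⟨k, rfl⟩ := Nat.exists_eq_add_of_lt hst
  rcases ht.eq_or_lt with rfl | ht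
  · have := h.2 s f ⟨fun r hr => h.1.1 r (by omega), fun r hr => h.1.2 r (by omega)⟩ rfl heq
    omega
  · refine h.not_cut (t := s) (k := k + 1) (by omega) (by omega) ?_ (fun hs => ?_) (fun hr => ?_)
    · rw [heq]; exact h.1.1 _ ht
    · obtain ⟨s, rfl⟩ := Nat.exists_eq_add_of_lt hs
      have h1 := h.1.2 (0 + s) (by omega)
      have h2 := h.1.2 (0 + s + 1 + k) (by omega)
      rw [← heq] at h2
      refine ⟨fun ⟨ha, hc⟩ => ?_, fun hn hC => ?_⟩
      · by_cases hb : E (f (0 + s + 2)) (f (0 + s + 1))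
        · exact h1.1 ⟨ha, hb⟩
        · have hout := (h.1.1 (0 + s + 1) (by omega)).resolve_right hb
          refine (h.1.follow hout k (by omega)).elim id fun hcyc => ?_
          rw [← heq] at hcyc
          exact absurd hcyc.1 (hE _)
      · by_cases ha : E (f (0 + s)) (f (0 + s + 1))
        · exact h2.2 (fun h' => hn ⟨ha, h'.2⟩) hC
        · exact h1.2 (fun h' => ha h'.1) hC
    · rw [heq]; exact h.1.2 _ hr

theorem dSep_iff_not_activeWalk (hE : Acyclic E) {i j : V} (hij : i ≠ j) :
    DSep E i j C ↔ ∀ n f, f 0 = i → f n = j → ¬ ActiveWalk E C n f := by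
  refine ⟨fun h n f hi hj hw => ?_, fun h n f hp hc => ?_⟩
  · obtain ⟨m, g, hg, h0, hm⟩ := hw.exists_shortest
    rw [hi] at h0
    rw [hj] at hm
    refine h m g ⟨?_, h0, hm, fun s t hs ht hst => ?_, hg.1.1⟩ fun t ht htm => ?_
    · exact Nat.pos_of_ne_zero fun h => hij (by rw [← h0, ← hm, h])
    · by_contra hne
      rcases Nat.lt_or_gt_of_ne hne with hlt | hlt
      · exact hg.injective hE hlt ht hst
      · exact hg.injective hE hlt hs hst.symm
    · obtain ⟨t, rfl⟩ := Nat.exists_eq_add_of_lt ht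
      have := hg.1.2 (0 + t) (by omega)
      exact ⟨fun hcol => Or.inr (this.1 hcol), this.2⟩
  · refine h n f hp.2.1 hp.2.2.1 ⟨hp.2.2.2.2, fun t ht => ?_⟩
    have := hc (t + 1) (by omega) ht
    exact ⟨fun hcol => (this.1 hcol).elim HasDescIn.of_mem id, this.2⟩

end Walks

section MarkovToStructure

variable {E : V → V → Prop}

theorem mem_indep_iff (hE : Acyclic E) {i j : V} {C : Finset V} :
    (i, j, C) ∈ Indep E ↔ i ≠ j ∧ i ∉ C ∧ j ∉ C ∧
      ∀ n f, f 0 = i → f n = j → ¬ ActiveWalk E C n f := by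
  simp only [Indep, Set.mem_ofPred_eq]
  exact and_congr_right fun hij => by rw [dSep_iff_not_activeWalk hE hij]

theorem mem_indep_symm (hE : Acyclic E) {i j : V} {C : Finset V} (h : (i, j, C) ∈ Indep E) :
    (j, i, C) ∈ Indep E := by
  rw [mem_indep_iff hE] at h ⊢
  exact ⟨h.1.symm, h.2.2.1, h.2.1, fun n f h0 hn hw =>
    h.2.2.2 n _ (by simpa using hn) (by simpa using h0) hw.reverse⟩

theorem notMem_indep_of_adj (hE : Acyclic E) {i j : V} {C : Finset V} (h : Adj E i j) :
    (i, j, C) ∉ Indep E := by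
  rw [mem_indep_iff hE]
  rintro ⟨-, -, -, hw⟩
  refine hw 1 (fun s => if s = 0 then i else j) rfl rfl ⟨fun t ht => ?_, fun t ht => ?_⟩
  · obtain rfl : t = 0 := by omega
    simpa using h
  · omega

theorem exists_indep_of_not_desc [Finite V] (hE : Acyclic E) {i j : V} (hij : i ≠ j)
    (hadj : ¬ Adj E i j) (hdesc : ¬ Desc E j i) : ∃ C, (i, j, C) ∈ Indep E := by
  refine ⟨(Set.toFinite {a | E a j}).toFinset, mem_indep_symm hE ?_⟩
  rw [mem_indep_iff hE]
  refine ⟨hij.symm, by simpa using hE.irrefl, by simpa using fun h => hadj (Or.inl h), ?_⟩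
  rintro n f rfl rfl hw
  have hn : 0 < n := Nat.pos_of_ne_zero fun h => hij (by rw [h])
  rcases hw.1 0 hn with hout | hin
  · obtain ⟨r, rfl⟩ := Nat.exists_eq_add_of_lt hn
    rcases hw.follow hout r le_rfl with ⟨d, hd, hreach⟩ | h
    · exact hE (f 0) (.tail' hreach (by simpa using hd))
    · exact hdesc h.1.to_reflTransGen
  · rcases (show n = 1 ∨ 1 < n by omega) with rfl | hn'
    · exact hadj (Or.inl hin)
    · exact (hw.2 0 hn').2 (fun h => hE.asymm hin h.1) (by simpa using hin)

theorem adj_iff_forall_notMem_indep [Finite V] (hE : Acyclic E) {i j : V} (hij : i ≠ j) :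
    Adj E i j ↔ ∀ C, (i, j, C) ∉ Indep E := by
  refine ⟨fun h C => notMem_indep_of_adj hE h, fun h => ?_⟩
  by_contra hadj
  by_cases hdesc : Desc E j i
  · have hdesc' : ¬ Desc E i j := fun h' => by
      rcases Relation.reflTransGen_iff_eq_or_transGen.1 h' with h' | h'
      · exact hij h'.symm
      · exact hE i (h'.trans_left hdesc)
    obtain ⟨C, hC⟩ := exists_indep_of_not_desc hE hij.symm (fun h => hadj h.symm) hdesc'
    exact h C (mem_indep_symm hE hC)
  · obtain ⟨C, hC⟩ := exists_indep_of_not_desc hE hij hadj hdesc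
    exact h C hC

theorem collider_iff_notMem_of_indep (hE : Acyclic E) {a b c : V} {C : Finset V}
    (hab : Adj E a b) (hcb : Adj E c b) (h : (a, c, C) ∈ Indep E) :
    E a b ∧ E c b ↔ b ∉ C := by
  rw [mem_indep_iff hE] at h
  have hblock : ¬ Passable E C a b c := fun hp => by
    refine h.2.2.2 2 (fun s => if s = 0 then a else if s = 1 then b else c) rfl rfl
      ⟨fun t ht => ?_, fun t ht => ?_⟩
    · rcases (show t = 0 ∨ t = 1 by omega) with rfl | rfl
      · simpa using hab
      · simpa using hcb.symm
    · obtain rfl : t = 0 := by omega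
      simpa using hp
  refine ⟨fun hcol hb => hblock ⟨fun _ => .of_mem hb, fun h' => absurd hcol h'⟩, fun hb => ?_⟩
  by_contra hcol
  exact hblock ⟨fun h' => absurd h' hcol, fun _ => hb⟩

theorem MarkovEquiv.sameSkeleton [Finite V] {G G' : V → V → Prop} (hG : Acyclic G)
    (hG' : Acyclic G') (h : MarkovEquiv G G') : SameSkeleton G G' := by
  intro i j
  by_cases hij : i = j
  · subst hij
    simp [Adj, hG.irrefl, hG'.irrefl]
  · rw [adj_iff_forall_notMem_indep hG hij, adj_iff_forall_notMem_indep hG' hij, h]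

theorem SameSkeleton.symm {G G' : V → V → Prop} (h : SameSkeleton G G') : SameSkeleton G' G :=
  fun i j => (h i j).symm

theorem MarkovEquiv.vStruct_subset [Finite V] {G G' : V → V → Prop} (hG : Acyclic G)
    (hG' : Acyclic G') (h : MarkovEquiv G G') : VStruct G ⊆ VStruct G' := by
  rintro ⟨a, b, c⟩ ⟨hab, hcb, hac, hadj⟩
  have hs := h.sameSkeleton hG hG'
  dsimp only at hab hcb hac hadj
  have hadj' := hadj
  rw [adj_iff_forall_notMem_indep hG hac] at hadj'
  push Not at hadj'
  obtain ⟨C, hC⟩ := hadj'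
  have hb := (collider_iff_notMem_of_indep hG (Or.inl hab) (Or.inl hcb) hC).1 ⟨hab, hcb⟩
  rw [h] at hC
  have := (collider_iff_notMem_of_indep hG' ((hs a b).1 (Or.inl hab)) ((hs c b).1 (Or.inl hcb))
    hC).2 hb
  exact ⟨this.1, this.2, hac, fun h' => hadj ((hs a c).2 h')⟩

theorem MarkovEquiv.vStruct_eq [Finite V] {G G' : V → V → Prop} (hG : Acyclic G)
    (hG' : Acyclic G') (h : MarkovEquiv G G') : VStruct G = VStruct G' :=
  (h.vStruct_subset hG hG').antisymm (MarkovEquiv.vStruct_subset hG' hG (Eq.symm h))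

end MarkovToStructure

section CoveredEdges

/-- The edge `x → y` is covered: `x` and `y` have the same parents apart from `x`. -/
def Covered (E : V → V → Prop) (x y : V) : Prop :=
  E x y ∧ ∀ z, z ≠ x → (E z y ↔ E z x)

/-- The graph obtained by reversing the edge `x → y`. -/
def reverseEdge (E : V → V → Prop) (x y : V) (a b : V) : Prop :=
  (E a b ∧ ¬ (a = x ∧ b = y)) ∨ (a = y ∧ b = x)

variable {E : V → V → Prop} {x y : V}

theorem Covered.ne (hE : Acyclic E) (h : Covered E x y) : x ≠ y :=
  fun h' => hE.irrefl (h' ▸ h.1)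

theorem Covered.acyclic_reverseEdge (hE : Acyclic E) (h : Covered E x y) :
    Acyclic (reverseEdge E x y) := by
  have hxy := h.ne hE
  have key : ∀ a b, Relation.TransGen (reverseEdge E x y) a b →
      (Relation.TransGen E a b ∧ ¬ (a = x ∧ b = y)) ∨
        (a = y ∧ b ≠ y ∧ (b = x ∨ Relation.TransGen E x b)) := by
    intro a b hab
    induction hab with
    | single hab =>
      rcases hab with ⟨hab, hne⟩ | ⟨rfl, rfl⟩
      · exact Or.inl ⟨.single hab, hne⟩
      · exact Or.inr ⟨rfl, hxy, Or.inl rfl⟩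
    | @tail b c _ hbc ih =>
      rcases ih with ⟨ih, hne⟩ | ⟨rfl, hby, ih⟩
      · rcases hbc with ⟨hbc, hne'⟩ | ⟨rfl, rfl⟩
        · refine Or.inl ⟨ih.tail hbc, ?_⟩
          rintro ⟨rfl, rfl⟩
          have hba : b ≠ a := fun h' => hne' ⟨h', rfl⟩
          exact hE a (ih.tail ((h.2 b hba).1 hbc))
        · refine Or.inl ⟨?_, fun h' => hxy h'.2⟩
          obtain ⟨z, haz, hzy⟩ := Relation.TransGen.tail'_iff.1 ih
          by_cases hz : z = c
          · subst hz
            rcases Relation.reflTransGen_iff_eq_or_transGen.1 haz with h' | h'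
            · exact absurd ⟨h'.symm, rfl⟩ hne
            · exact h'
          · exact .tail' haz ((h.2 z hz).1 hzy)
      · rcases hbc with ⟨hbc, hne'⟩ | ⟨rfl, rfl⟩
        · have hreach : Relation.TransGen E x c := by
            rcases ih with rfl | ih
            · exact .single hbc
            · exact ih.tail hbc
          refine Or.inr ⟨rfl, ?_, Or.inr hreach⟩
          rintro rfl
          have hbx : b ≠ x := fun h' => hne' ⟨h', rfl⟩
          exact hE x ((ih.resolve_left hbx).tail ((h.2 b hbx).1 hbc))
        · exact absurd rfl hby
  intro v hv
  rcases key v v hv with h' | h'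
  · exact hE v h'.1
  · exact h'.2.1 h'.1

theorem Covered.reverse (hE : Acyclic E) (h : Covered E x y) :
    Covered (reverseEdge E x y) y x := by
  have hxy := h.ne hE
  have hxx : ¬ E x x := hE.irrefl
  refine ⟨Or.inr ⟨rfl, rfl⟩, fun z hz => ?_⟩
  have := h.2 z
  unfold reverseEdge
  grind

theorem Covered.reverseEdge_reverseEdge (hE : Acyclic E) (h : Covered E x y) :
    reverseEdge (reverseEdge E x y) y x = E := by
  have hyx := hE.asymm h.1
  have hxy := h.1
  ext a b
  unfold reverseEdge
  grind

theorem Covered.sameSkeleton (h : Covered E x y) : SameSkeleton (reverseEdge E x y) E := by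
  have hxy := h.1
  intro a b
  unfold Adj reverseEdge
  grind

theorem Covered.vStruct_reverseEdge (hE : Acyclic E) (h : Covered E x y) :
    VStruct (reverseEdge E x y) = VStruct E := by
  have hxy := h.ne hE
  have hyx := hE.asymm h.1
  have hxx : ¬ E x x := hE.irrefl
  ext ⟨a, b, c⟩
  have hs := h.sameSkeleton a c
  simp only [VStruct, Set.mem_ofPred_eq, hs]
  have ha := h.2 a
  have hc := h.2 c
  unfold reverseEdge Adj
  grind

/-- Reversing a covered edge preserves having a descendant in `C`, except possibly at its tail. -/
theorem Covered.hasDescIn_reverseEdge (h : Covered E x y) {C : Finset V} {b : V}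
    (hb : HasDescIn E C b) :
    HasDescIn (reverseEdge E x y) C b ∨ (b = x ∧ HasDescIn (reverseEdge E x y) C y) := by
  obtain ⟨d, hd, hbd⟩ := hb
  induction hbd using Relation.ReflTransGen.head_induction_on with
  | refl => exact Or.inl (.of_mem hd)
  | @head a b hab _ ih =>
    rcases ih with ih | ⟨rfl, ih⟩
    · by_cases hxy : a = x ∧ b = y
      · obtain ⟨rfl, rfl⟩ := hxy
        exact Or.inr ⟨rfl, ih⟩
      · exact Or.inl (ih.of_desc (.single (Or.inl ⟨hab, hxy⟩)))
    · by_cases hax : a = b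
      · exact Or.inr ⟨hax, ih⟩
      · exact Or.inl (ih.of_desc (.single (Or.inl ⟨(h.2 a hax).2 hab, fun h' => hax h'.1⟩)))

variable {C : Finset V} {n : ℕ} {f : ℕ → V}

theorem Covered.not_into_tail (hE : Acyclic E) (h : Covered E x y) (hf : ShortestWalk E C n f)
    {t : ℕ} (ht : t + 1 < n) (hx : f (t + 1) = x) (hy : f (t + 2) = y) : ¬ E (f t) x := by
  intro hin
  have hne : f t ≠ x := fun h' => hE.irrefl (h' ▸ hin)
  have hin' := (h.2 _ hne).2 hin
  refine hf.not_cut (t := t) (k := 1) one_pos ht (Or.inl (hy ▸ hin')) (fun h0 => ?_) (fun hr => ?_)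
  · obtain ⟨s, rfl⟩ := Nat.exists_eq_add_of_lt h0
    have hp := hf.1.2 (0 + s) (by omega)
    refine ⟨fun h' => absurd h'.2 (hE.asymm (hy ▸ hin')), fun _ => hp.2 fun h' => ?_⟩
    have h2 := h'.2
    rw [show 0 + s + 2 = 0 + s + 1 + 1 from rfl, hx] at h2
    exact hE.asymm hin h2
  · have hp := hf.1.2 (t + 1) hr
    have hxy := h.1
    unfold Passable at hp ⊢
    simp only [add_assoc, Nat.reduceAdd] at hp hx hy ⊢
    simp only [hx, hy] at hp ⊢
    simpa [hin', hxy] using hp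

theorem Covered.not_into_head (hE : Acyclic E) (h : Covered E x y) (hf : ShortestWalk E C n f)
    {t : ℕ} (ht : t + 1 < n) (hx : f t = x) (hy : f (t + 1) = y) : ¬ E (f (t + 2)) y := by
  intro hin
  have hne : f (t + 2) ≠ x := hx ▸ (hf.injective hE (by omega) (by omega)).symm
  have hin' := (h.2 _ hne).1 hin
  refine hf.not_cut (t := t) (k := 1) one_pos ht (Or.inr (hx ▸ hin')) (fun h0 => ?_) (fun hr => ?_)
  · obtain ⟨s, rfl⟩ := Nat.exists_eq_add_of_lt h0
    have hp := hf.1.2 (0 + s) (by omega)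
    have hno := h.not_into_tail hE hf (t := 0 + s) (by omega) hx hy
    refine ⟨fun h' => absurd h'.1 (hx ▸ hno), fun _ => hp.2 fun h' => ?_⟩
    exact hno (hx ▸ h'.1)
  · have hp := hf.1.2 (t + 1) hr
    refine ⟨fun h' => absurd h'.1 (hE.asymm (hx ▸ hin')), fun _ => hp.2 fun h' => ?_⟩
    exact hE.asymm hin (hy ▸ h'.1)

theorem reverseEdge_iff_of_ne {a b : V} (ha : a ≠ x) (hb : b ≠ x) :
    reverseEdge E x y a b ↔ E a b := by
  simp [reverseEdge, ha, hb]

theorem Covered.exists_activeWalk_reverseEdge (hE : Acyclic E) (h : Covered E x y)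
    (hw : ActiveWalk E C n f) :
    ∃ m g, ActiveWalk (reverseEdge E x y) C m g ∧ g 0 = f 0 ∧ g m = f n := by
  obtain ⟨n, f, hf, h0, hn⟩ := hw.exists_shortest
  rw [← h0, ← hn]
  clear h0 hn hw
  have hinj : ∀ s t, s ≤ n → t ≤ n → f s = f t → s = t := fun s t hs ht hst => by
    by_contra hne
    rcases Nat.lt_or_gt_of_ne hne with hlt | hlt
    · exact hf.injective hE hlt ht hst
    · exact hf.injective hE hlt hs hst.symm
  by_cases hx : ∃ t, t + 1 < n ∧ f (t + 1) = x ∧ E (f t) x ∧ E (f (t + 2)) x ∧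
      ¬ HasDescIn (reverseEdge E x y) C x
  · obtain ⟨t, ht, htx, hax, hcx, hdesc⟩ := hx
    have hpos : ∀ s, s ≤ n → f s = x → s = t + 1 := fun s hs hsx =>
      hinj s (t + 1) hs ht.le (hsx.trans htx.symm)
    have hto : ∀ a, E a x → reverseEdge E x y a y := fun a ha =>
      have hne : a ≠ x := fun h' => hE.irrefl (h' ▸ ha)
      Or.inl ⟨(h.2 a hne).2 ha, fun h' => hne h'.1⟩
    have hnot : ∀ a, E a x → ¬ reverseEdge E x y y a := fun a ha h' =>
      h.acyclic_reverseEdge hE |>.asymm h' (hto a ha)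
    have hne : ∀ s, s ≤ n → s ≠ t + 1 → f s ≠ x := fun s hs hst hsx => hst (hpos s hs hsx)
    refine ⟨n, fun s => if s = t + 1 then y else f s, ⟨fun s hs => ?_, fun s hs => ?_⟩, ?_, ?_⟩
    · by_cases h1 : s = t + 1
      · subst h1
        simpa [Adj] using Or.inr (hto _ hcx)
      · by_cases h2 : s = t
        · subst h2
          simpa [Adj] using Or.inl (hto _ hax)
        · simpa [h1, h2, Adj, reverseEdge_iff_of_ne, hne _ hs.le h1,
            hne (s + 1) hs (by omega)] using hf.1.1 s hs
    · have hp := hf.1.2 s hs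
      rcases (show s = t ∨ s = t + 1 ∨ s + 1 = t ∨ (s ≠ t ∧ s ≠ t + 1 ∧ s + 1 ≠ t) by omega) with
        rfl | rfl | rfl | ⟨h1, h2, h3⟩
      · have hy := (h.hasDescIn_reverseEdge (hp.1 ⟨htx ▸ hax, htx ▸ hcx⟩)).resolve_left
          (htx ▸ hdesc)
        simpa [Passable] using ⟨fun _ _ => hy.2, fun h' => absurd (hto _ hcx) (h' (hto _ hax))⟩
      · have hC := hp.2 fun h' => hE.asymm (htx ▸ h'.1) hcx
        simpa [Passable] using ⟨fun h' => absurd h' (hnot _ hcx), fun _ => hC⟩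
      · have hC := hp.2 fun h' => hE.asymm (htx ▸ h'.2) hax
        simpa [Passable, show s ≠ s + 1 + 1 by omega] using
          ⟨fun _ h' => absurd h' (hnot _ hax), fun _ => hC⟩
      · have hb := hne (s + 1) (by omega) (by omega)
        have hd : HasDescIn E C (f (s + 1)) → HasDescIn (reverseEdge E x y) C (f (s + 1)) :=
          fun h' => (h.hasDescIn_reverseEdge h').resolve_right fun h'' => hb h''.1
        have hp' : Passable (reverseEdge E x y) C (f s) (f (s + 1)) (f (s + 2)) := by
          unfold Passable
          rw [reverseEdge_iff_of_ne (hne s (by omega) h2) hb,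
            reverseEdge_iff_of_ne (hne (s + 2) (by omega) (by omega)) hb]
          exact ⟨fun h' => hd (hp.1 h'), hp.2⟩
        simpa [h1, h2, show s + 2 ≠ t + 1 by omega] using hp'
    · simp
    · simp [ht.ne']
  · push Not at hx
    have hskel := h.sameSkeleton
    refine ⟨n, f, ⟨fun t ht => (hskel _ _).2 (hf.1.1 t ht), fun t ht => ?_⟩, rfl, rfl⟩
    have hp := hf.1.2 t ht
    have hr := hf.reverse
    have e0 : n - (n - (t + 2)) = t + 2 := by omega
    have e1 : n - (n - (t + 2) + 1) = t + 1 := by omega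
    have e2 : n - (n - (t + 2) + 2) = t := by omega
    have tail₁ : f (t + 1) = x → f (t + 2) = y → ¬ E (f t) x := h.not_into_tail hE hf ht
    have head₁ : f t = x → f (t + 1) = y → ¬ E (f (t + 2)) y := h.not_into_head hE hf ht
    have tail₂ := h.not_into_tail hE hr (t := n - (t + 2)) (by omega)
    have head₂ := h.not_into_head hE hr (t := n - (t + 2)) (by omega)
    simp only [e0, e1, e2] at tail₂ head₂
    have hac : f t ≠ f (t + 2) := fun h' => by
      have := hinj _ _ (by omega) (by omega) h'
      omega
    have hcol : reverseEdge E x y (f t) (f (t + 1)) ∧ reverseEdge E x y (f (t + 2)) (f (t + 1)) ↔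
        E (f t) (f (t + 1)) ∧ E (f (t + 2)) (f (t + 1)) := by
      unfold reverseEdge
      grind
    unfold Passable
    rw [hcol]
    refine ⟨fun h' => ?_, hp.2⟩
    rcases h.hasDescIn_reverseEdge (hp.1 h') with hd | ⟨hbx, -⟩
    · exact hd
    · rw [hbx] at h' ⊢
      exact hx t ht hbx h'.1 h'.2

theorem Covered.indep_reverseEdge (hE : Acyclic E) (h : Covered E x y) :
    Indep (reverseEdge E x y) = Indep E := by
  ext ⟨i, j, C⟩
  rw [mem_indep_iff hE, mem_indep_iff (h.acyclic_reverseEdge hE)]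
  refine and_congr_right fun _ => and_congr_right fun _ => and_congr_right fun _ =>
    ⟨fun hr n f h0 hn hw => ?_, fun hr n f h0 hn hw => ?_⟩
  · obtain ⟨m, g, hg, hg0, hgm⟩ := h.exists_activeWalk_reverseEdge hE hw
    exact hr m g (hg0.trans h0) (hgm.trans hn) hg
  · obtain ⟨m, g, hg, hg0, hgm⟩ := (h.reverse hE).exists_activeWalk_reverseEdge
      (h.acyclic_reverseEdge hE) hw
    rw [h.reverseEdge_reverseEdge hE] at hg
    exact hr m g (hg0.trans h0) (hgm.trans hn) hg

end CoveredEdges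

section StructureToMarkov

variable {G G' : V → V → Prop}

theorem Acyclic.wellFounded [Finite V] {E : V → V → Prop} (hE : Acyclic E) : WellFounded E := by
  have : Std.Irrefl (Relation.TransGen E) := ⟨hE⟩
  exact Subrelation.wf Relation.TransGen.single
    (Finite.wellFounded_of_trans_of_irrefl (Relation.TransGen E))

theorem Acyclic.swap {E : V → V → Prop} (hE : Acyclic E) : Acyclic (Function.swap E) :=
  fun v h => hE v (Relation.transGen_swap.1 h)

theorem exists_reversed_of_ne (hG' : Acyclic G') (hs : SameSkeleton G G') (hne : G ≠ G') :
    ∃ a b, G a b ∧ G' b a := by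
  by_contra! hno
  refine hne (funext₂ fun a b => propext ⟨fun h => ?_, fun h => ?_⟩)
  · exact ((hs a b).1 (Or.inl h)).resolve_right (hno a b h)
  · refine ((hs a b).2 (Or.inl h)).resolve_right fun hba => ?_
    exact ((hs b a).1 (Or.inl hba)).elim (hG'.asymm h) (hno b a hba)

/-- Two different graphs with the same skeleton and v-structures disagree on some covered edge. -/
theorem exists_covered_of_ne [Finite V] (hG : Acyclic G) (hG' : Acyclic G')
    (hs : SameSkeleton G G') (hv : VStruct G = VStruct G') (hne : G ≠ G') :
    ∃ x y, Covered G x y ∧ G' y x := by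
  obtain ⟨a, b, hab, hba⟩ := exists_reversed_of_ne hG' hs hne
  obtain ⟨y, ⟨x₀, hx₀⟩, hymin⟩ :=
    hG.wellFounded.has_min {y | ∃ x, G x y ∧ G' y x} ⟨b, a, hab, hba⟩
  obtain ⟨x, ⟨hxy, hyx⟩, hxmax⟩ :=
    hG.swap.wellFounded.has_min {x | G x y ∧ G' y x} ⟨x₀, hx₀⟩
  have hkeep : ∀ u v, G v y → G u v → G' u v := fun u v hvy huv =>
    ((hs u v).1 (Or.inl huv)).resolve_right fun h => hymin v ⟨u, huv, h⟩ hvy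
  refine ⟨x, y, ⟨hxy, fun z hzx => ⟨fun hzy => ?_, fun hzx' => ?_⟩⟩, hyx⟩
  · have hadj : Adj G x z := by
      by_contra hadj
      have hmem : (x, y, z) ∈ VStruct G := ⟨hxy, hzy, hzx.symm, hadj⟩
      rw [hv] at hmem
      exact hG'.asymm hyx hmem.1
    refine hadj.resolve_left fun hxz => ?_
    have hxz' := hkeep x z hzy hxz
    have hyz := hG'.of_adj_of_path hyx hxz' ((hs y z).1 (Or.inr hzy))
    exact hxmax z ⟨hzy, hyz⟩ hxz
  · refine hG.of_adj_of_path hzx' hxy ?_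
    by_contra hadj
    have hzy : z ≠ y := fun h => hG.asymm hxy (h ▸ hzx')
    have hmem : (z, x, y) ∈ VStruct G' :=
      ⟨hkeep z x hxy hzx', hyx, hzy, fun h => hadj ((hs z y).2 h)⟩
    rw [← hv] at hmem
    exact hG.asymm hxy hmem.2.1

theorem markovEquiv_of_sameSkeleton_of_vStruct_eq [Finite V] (hG : Acyclic G) (hG' : Acyclic G')
    (hs : SameSkeleton G G') (hv : VStruct G = VStruct G') : MarkovEquiv G G' := by
  induction hn : {e : V × V | G e.1 e.2 ∧ G' e.2 e.1}.ncard using Nat.strong_induction_on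
    generalizing G with
  | _ n ih =>
    by_cases hne : G = G'
    · exact congrArg Indep hne
    · obtain ⟨x, y, hxy, hyx⟩ := exists_covered_of_ne hG hG' hs hv hne
      refine (hxy.indep_reverseEdge hG).symm.trans (ih _ ?_ (hxy.acyclic_reverseEdge hG)
        (fun i j => (hxy.sameSkeleton i j).trans (hs i j))
        ((hxy.vStruct_reverseEdge hG).trans hv) rfl)
      rw [← hn]
      refine Set.ncard_lt_ncard ⟨?_, fun hsub => ?_⟩ (Set.toFinite _)
      · rintro ⟨a, b⟩ ⟨⟨hab, -⟩ | ⟨rfl, rfl⟩, hba⟩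
        · exact ⟨hab, hba⟩
        · exact absurd hyx (hG'.asymm hba)
      · have hmem : (x, y) ∈ {e : V × V | G e.1 e.2 ∧ G' e.2 e.1} := ⟨hxy.1, hyx⟩
        rcases (hsub hmem).1 with ⟨-, h⟩ | ⟨h, -⟩
        · exact h ⟨rfl, rfl⟩
        · exact hxy.ne hG h

theorem markovEquiv_iff_sameSkeleton_and_vStruct_eq [Finite V] (hG : Acyclic G)
    (hG' : Acyclic G') : MarkovEquiv G G' ↔ SameSkeleton G G' ∧ VStruct G = VStruct G' :=
  ⟨fun h => ⟨h.sameSkeleton hG hG', h.vStruct_eq hG hG'⟩,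
    fun h => markovEquiv_of_sameSkeleton_of_vStruct_eq hG hG' h.1 h.2⟩

end StructureToMarkov

section Apex

/-- Some vertex of `S` is a child of all the other vertices of `S`. -/
def HasApex (E : V → V → Prop) (S : Finset V) : Prop :=
  ∃ i ∈ S, ∀ j ∈ S, j ≠ i → E j i

variable {G G' : V → V → Prop}

theorem adj_iff_hasApex {E : V → V → Prop} [DecidableEq V] {a b : V} (hab : a ≠ b) :
    Adj E a b ↔ HasApex E {a, b} := by
  simp [HasApex, Adj, hab, hab.symm, or_comm]

theorem hasApex_triple_iff {E : V → V → Prop} [DecidableEq V] {a b c : V} (hab : a ≠ b)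
    (hbc : b ≠ c) (hac : a ≠ c) (hadj : ¬ Adj E a c) :
    HasApex E {a, b, c} ↔ E a b ∧ E c b := by
  unfold Adj at hadj
  push Not at hadj
  simp [HasApex, hab, hab.symm, hbc, hbc.symm, hac, hac.symm, hadj]

theorem HasApex.of_sameSkeleton_of_vStruct_eq [Finite V] (hG' : Acyclic G')
    (hs : SameSkeleton G G') (hv : VStruct G = VStruct G') {S : Finset V} (h : HasApex G S) :
    HasApex G' S := by
  obtain ⟨i, hi, hpar⟩ := h
  obtain ⟨k, ⟨hk, hkadj⟩, hkmax⟩ := hG'.swap.wellFounded.has_min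
    {k | k ∈ S ∧ ∀ j ∈ S, j ≠ k → Adj G' j k}
    ⟨i, hi, fun j hj hji => (hs j i).1 (Or.inl (hpar j hj hji))⟩
  refine ⟨k, hk, fun j hj hjk => (hkadj j hj hjk).resolve_right fun hkj => ?_⟩
  have hj' : ¬ ∀ l ∈ S, l ≠ j → Adj G' l j := fun h => hkmax j ⟨hj, h⟩ hkj
  push Not at hj'
  obtain ⟨l, hl, hlj, hadj⟩ := hj'
  have hji : j ≠ i := by
    rintro rfl
    exact hadj ((hs l j).1 (Or.inl (hpar l hl hlj)))
  have hli : l ≠ i := by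
    rintro rfl
    exact hadj ((hs l j).1 (Or.inr (hpar j hj hji)))
  have hmem : (l, i, j) ∈ VStruct G :=
    ⟨hpar l hl hli, hpar j hj hji, hlj, fun h => hadj ((hs l j).1 h)⟩
  rw [hv] at hmem
  have hji' : G' j i := hmem.2.1
  rcases eq_or_ne i k with rfl | hik
  · exact hG'.asymm hkj hji'
  · rcases hkadj i hi hik with h | h
    · exact hG' k (.tail (.tail (.single hkj) hji') h)
    · exact hkmax i ⟨hi, fun m hm hmi => (hs m i).1 (Or.inl (hpar m hm hmi))⟩ h

theorem vStruct_subset_of_hasApex_iff (hG : Acyclic G) (hs : SameSkeleton G G')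
    (h : ∀ S : Finset V, S.Nonempty → (HasApex G S ↔ HasApex G' S)) :
    VStruct G ⊆ VStruct G' := by
  classical
  rintro ⟨a, b, c⟩ ⟨hab, hcb, hac, hadj⟩
  dsimp only at hab hcb hac hadj
  have hne : ∀ {u v : V}, G u v → u ≠ v := fun huv h' => hG.irrefl (h' ▸ huv)
  have hadj' : ¬ Adj G' a c := fun h' => hadj ((hs a c).2 h')
  have hcol := (hasApex_triple_iff (hne hab) (hne hcb).symm hac hadj).2 ⟨hab, hcb⟩
  rw [h _ ⟨a, by simp⟩, hasApex_triple_iff (hne hab) (hne hcb).symm hac hadj'] at hcol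
  exact ⟨hcol.1, hcol.2, hac, hadj'⟩

theorem sameSkeleton_and_vStruct_eq_iff_hasApex [Finite V] (hG : Acyclic G) (hG' : Acyclic G') :
    SameSkeleton G G' ∧ VStruct G = VStruct G' ↔
      ∀ S : Finset V, S.Nonempty → (HasApex G S ↔ HasApex G' S) := by
  classical
  refine ⟨fun ⟨hs, hv⟩ S _ => ⟨fun h => h.of_sameSkeleton_of_vStruct_eq hG' hs hv,
    fun h => h.of_sameSkeleton_of_vStruct_eq hG hs.symm hv.symm⟩, fun h => ?_⟩
  have hs : SameSkeleton G G' := fun i j => by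
    by_cases hij : i = j
    · subst hij
      simp [Adj, hG.irrefl, hG'.irrefl]
    · rw [adj_iff_hasApex hij, adj_iff_hasApex hij, h _ ⟨i, by simp⟩]
  exact ⟨hs, (vStruct_subset_of_hasApex_iff hG hs h).antisymm
    (vStruct_subset_of_hasApex_iff hG' hs.symm fun S hS => (h S hS).symm)⟩

end Apex

section Imset

variable {p : ℕ}

theorem sum_supersets_delta (S A : Finset (Fin p)) :
    ∑ T with S ⊆ T, delta A T = if S ⊆ A then 1 else 0 := by
  simp [delta]

theorem eq_of_sum_supersets_eq {u v : Finset (Fin p) → ℤ}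
    (h : ∀ S, ∑ T with S ⊆ T, u T = ∑ T with S ⊆ T, v T) : u = v := by
  funext S
  induction S using WellFoundedGT.induction with
  | _ S ih =>
    have hS := h S
    have hmem : S ∈ Finset.univ.filter (S ⊆ ·) := by simp
    rw [← Finset.add_sum_erase _ _ hmem, ← Finset.add_sum_erase _ _ hmem,
      Finset.sum_congr rfl fun T hT => ih T ?_] at hS
    · exact add_right_cancel hS
    · simp only [Finset.mem_erase, Finset.mem_filter] at hT
      exact lt_of_le_of_ne hT.2.2 hT.1.symm

theorem sum_supersets_standardImset (E : Fin p → Fin p → Prop) (S : Finset (Fin p)) :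
    ∑ T with S ⊆ T, standardImset E T = 1 - (if S ⊆ ∅ then 1 else 0) +
      ∑ i, ((if S ⊆ parents E i then 1 else 0) -
        if S ⊆ insert i (parents E i) then 1 else 0) := by
  simp only [standardImset, Finset.sum_add_distrib, Finset.sum_sub_distrib (delta Finset.univ),
    sum_supersets_delta, Finset.subset_univ, if_true]
  rw [Finset.sum_comm]
  simp only [Finset.sum_sub_distrib, sum_supersets_delta]

open Classical in
theorem sum_supersets_standardImset_eq_hasApex {E : Fin p → Fin p → Prop} (hE : Acyclic E)
    {S : Finset (Fin p)} (hS : S.Nonempty) :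
    ∑ T with S ⊆ T, standardImset E T = 1 - if HasApex E S then 1 else 0 := by
  have hterm : ∀ i, ((if S ⊆ parents E i then 1 else 0) -
      if S ⊆ insert i (parents E i) then 1 else 0 : ℤ) =
        -if i ∈ S ∧ ∀ j ∈ S, j ≠ i → E j i then 1 else 0 := by
    intro i
    have hpa : S ⊆ parents E i ↔ ∀ j ∈ S, E j i := by simp [Finset.subset_iff, parents]
    have hins : S ⊆ insert i (parents E i) ↔ ∀ j ∈ S, j ≠ i → E j i := by
      simp [Finset.subset_iff, parents, or_iff_not_imp_left]
    simp only [hpa, hins]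
    by_cases hi : i ∈ S
    · have hno : ¬ ∀ j ∈ S, E j i := fun h => hE.irrefl (h i hi)
      simp [hi, hno]
    · have hiff : (∀ j ∈ S, j ≠ i → E j i) ↔ ∀ j ∈ S, E j i :=
        forall₂_congr fun j hj => ⟨fun h => h fun hji => hi (hji ▸ hj), fun h _ => h⟩
      simp [hi, hiff]
  have hsum : ∑ i, (if i ∈ S ∧ ∀ j ∈ S, j ≠ i → E j i then 1 else 0 : ℤ) =
      if HasApex E S then 1 else 0 := by
    split_ifs with h
    · obtain ⟨i, hi, hpar⟩ := h
      rw [Finset.sum_eq_single i]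
      · exact if_pos ⟨hi, hpar⟩
      · exact fun k _ hki => if_neg fun h' =>
          hE.asymm (hpar k h'.1 hki) (h'.2 i hi hki.symm)
      · simp
    · exact Finset.sum_eq_zero fun i _ => if_neg fun h' => h ⟨i, h'⟩
  rw [sum_supersets_standardImset, Finset.sum_congr rfl fun i _ => hterm i,
    Finset.sum_neg_distrib, hsum]
  simp [hS.ne_empty, sub_eq_add_neg]

theorem standardImset_eq_iff_hasApex {G G' : Fin p → Fin p → Prop} (hG : Acyclic G)
    (hG' : Acyclic G') : standardImset G = standardImset G' ↔
      ∀ S : Finset (Fin p), S.Nonempty → (HasApex G S ↔ HasApex G' S) := by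
  classical
  refine ⟨fun h S hS => ?_, fun h => eq_of_sum_supersets_eq fun S => ?_⟩
  · have hsum := sum_supersets_standardImset_eq_hasApex hG hS
    rw [h, sum_supersets_standardImset_eq_hasApex hG' hS] at hsum
    by_cases h1 : HasApex G S <;> by_cases h2 : HasApex G' S <;> simp_all
  · rcases S.eq_empty_or_nonempty with rfl | hS
    · rw [sum_supersets_standardImset, sum_supersets_standardImset]; simp
    · rw [sum_supersets_standardImset_eq_hasApex hG hS, sum_supersets_standardImset_eq_hasApex hG' hS]
      simp only [h S hS]

end Imset

/-- **Studený.** Two DAGs `G` and `G'` on `Fin p` are Markov equivalent if and only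
if their standard imsets are equal. -/
theorem markovEquiv_iff_standardImset_eq {p : ℕ} (G G' : Fin p → Fin p → Prop)
    (hG : Acyclic G) (hG' : Acyclic G') :
    MarkovEquiv G G' ↔ standardImset G = standardImset G' := by
  rw [markovEquiv_iff_sameSkeleton_and_vStruct_eq hG hG',
    sameSkeleton_and_vStruct_eq_iff_hasApex hG hG', standardImset_eq_iff_hasApex hG hG']

end CausalDiscovery
end

section
/- (Equivalence of the Markov factorization property and the global Markov property.) Let G be a DAG on Fin p and let P be a probability mass function on ∏_{i=1}^p 𝒳_i for finite nonempty sets 𝒳_i. Then P factorizes according to G if and only if P satisfies the global Markov property with respect to G. -/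
namespace CausalDiscovery

variable {V : Type*}

variable {p : ℕ} {𝒳 : Fin p → Type*} [∀ i, Fintype (𝒳 i)]

/-- `P` is a probability mass function: nonnegative and summing to 1. -/
def IsPMF (P : (∀ i, 𝒳 i) → ℝ) : Prop :=
  (∀ x, 0 ≤ P x) ∧ ∑ x, P x = 1

open Classical in
/-- The marginal `P(x_S)`, obtained by summing out the coordinates outside `S`. -/
noncomputable def margin (P : (∀ i, 𝒳 i) → ℝ) (S : Finset (Fin p)) (x : ∀ i, 𝒳 i) : ℝ :=
  ∑ y : ∀ i, 𝒳 i, if ∀ i ∈ S, y i = x i then P y else 0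

/-- `X_A` and `X_B` are conditionally independent given `X_C` under `P`:
for all `x`, `P(x_{A∪B∪C})·P(x_C) = P(x_{A∪C})·P(x_{B∪C})`. -/
def CondIndep (P : (∀ i, 𝒳 i) → ℝ) (A B C : Finset (Fin p)) : Prop :=
  ∀ x, margin P (A ∪ B ∪ C) x * margin P C x = margin P (A ∪ C) x * margin P (B ∪ C) x

/-- `E` satisfies the global Markov property for `P` (`E` is an I-MAP of `P`):
d-separation implies conditional independence. -/
def IsIMAP (E : Fin p → Fin p → Prop) (P : (∀ i, 𝒳 i) → ℝ) : Prop :=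
  ∀ i j (C : Finset (Fin p)), i ≠ j → i ∉ C → j ∉ C → DSep E i j C →
    CondIndep P {i} {j} C

/-- `P` factorizes according to `E`: there are nonnegative kernels
`φ i`, each depending only on `x i` and the values of the parents of `i`,
normalized in `x i`, whose product is `P`. -/
def Factorizes (E : Fin p → Fin p → Prop) (P : (∀ i, 𝒳 i) → ℝ) : Prop :=
  ∃ φ : ∀ _ : Fin p, (∀ i, 𝒳 i) → ℝ,
    (∀ i x, 0 ≤ φ i x) ∧
    (∀ i x y, x i = y i → (∀ k, E k i → x k = y k) → φ i x = φ i y) ∧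
    (∀ i x, ∑ a : 𝒳 i, φ i (Function.update x i a) = 1) ∧
    ∀ x, P x = ∏ i, φ i x

section Walks

variable {G : V → V → Prop} {C : Finset V} {i : V}

/-- `v` is in `C` or has a descendant in `C`. -/
def AncOf (G : V → V → Prop) (C : Finset V) (v : V) : Prop :=
  ∃ d ∈ C, Desc G v d

/-- `OpenWalk G C i v b`: some walk from `i`, possibly with repeated vertices, d-connects `i`
to `v` given `C`; if `b` is true, its last edge points into `v`. -/
inductive OpenWalk (G : V → V → Prop) (C : Finset V) (i : V) : V → Bool → Prop
  | refl : OpenWalk G C i i false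
  | forward {v w : V} {b : Bool} : OpenWalk G C i v b → v ∉ C → G v w → OpenWalk G C i w true
  | backward {v w : V} : OpenWalk G C i v false → v ∉ C → G w v → OpenWalk G C i w false
  | collider {v w : V} : OpenWalk G C i v true → AncOf G C v → G w v → OpenWalk G C i w false

lemma Acyclic.asymm_s8 (hG : Acyclic G) {v w : V} (h : G v w) : ¬ G w v := fun h' =>
  hG v ((Relation.TransGen.single h).tail h')

lemma AncOf.of_mem {v : V} (h : v ∈ C) : AncOf G C v := ⟨v, h, Relation.ReflTransGen.refl⟩

lemma AncOf.of_desc {v w : V} (h : Desc G v w) (hw : AncOf G C w) : AncOf G C v := by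
  obtain ⟨d, hd, hwd⟩ := hw
  exact ⟨d, hd, h.trans hwd⟩

lemma DConn.ancOf {n : ℕ} {f : ℕ → V} (h : DConn G n f C) {t : ℕ} (h0 : 0 < t) (hn : t < n)
    (ht : ColliderAt G f t) : AncOf G C (f t) := by
  rcases (h t h0 hn).1 ht with h | h
  · exact .of_mem h
  · exact h

lemma OpenWalk.exists_desc {v j : V} {b : Bool} (h : OpenWalk G C i v b)
    (hv : ¬ AncOf G C v) (hj : Desc G v j) : ∃ b, OpenWalk G C i j b := by
  induction hj with
  | refl => exact ⟨b, h⟩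
  | tail hvw hww' ih =>
    obtain ⟨b', hb⟩ := ih
    exact ⟨true, hb.forward (fun hc => hv (.of_desc hvw (.of_mem hc))) hww'⟩

lemma OpenWalk.of_desc {v : V} (hv : ¬ AncOf G C v) (hi : Desc G v i) :
    OpenWalk G C i v false := by
  induction hi using Relation.ReflTransGen.head_induction_on with
  | refl => exact .refl
  | head hvw _ ih =>
    have hw : ¬ AncOf G C _ := fun h => hv (.of_desc (Relation.ReflTransGen.single hvw) h)
    exact (ih hw).backward (fun hc => hw (.of_mem hc)) hvw

lemma OpenWalk.backward_or_reach [DecidableEq V] {j v w : V} (h : OpenWalk G C i v true)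
    (hv : AncOf G (insert i (insert j C)) v) (hw : G w v) :
    OpenWalk G C i w false ∨ ∃ b, OpenWalk G C i j b := by
  by_cases hC : AncOf G C v
  · exact .inl (h.collider hC hw)
  obtain ⟨d, hd, hvd⟩ := hv
  rcases Finset.mem_insert.1 hd with rfl | hd
  · exact .inl ((OpenWalk.of_desc hC hvd).backward (fun hc => hC (.of_mem hc)) hw)
  rcases Finset.mem_insert.1 hd with rfl | hd
  · exact .inr (h.exists_desc hC hvd)
  · exact absurd ⟨d, hd, hvd⟩ hC

lemma OpenWalk.exists_fun (hG : Acyclic G) {v : V} {b : Bool} (h : OpenWalk G C i v b) :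
    ∃ n, ∃ f : ℕ → V, f 0 = i ∧ f n = v ∧ (∀ t, t < n → Adj G (f t) (f (t + 1))) ∧
      DConn G n f C ∧ (b = true → 0 < n ∧ G (f (n - 1)) (f n)) ∧
      (b = false → 0 < n → G (f n) (f (n - 1))) := by
  have extend : ∀ (n : ℕ) (f : ℕ → V) (w : V), f 0 = i →
      (∀ t, t < n → Adj G (f t) (f (t + 1))) → DConn G n f C → Adj G (f n) w →
      (0 < n → (G (f (n - 1)) (f n) ∧ G w (f n) → AncOf G C (f n)) ∧
        (¬ (G (f (n - 1)) (f n) ∧ G w (f n)) → f n ∉ C)) →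
      ∃ g : ℕ → V, g 0 = i ∧ g (n + 1) = w ∧ g n = f n ∧
        (∀ t, t < n + 1 → Adj G (g t) (g (t + 1))) ∧ DConn G (n + 1) g C := by
    intro n f w h0 hadj hd hw hn
    have old : ∀ t, t ≤ n → Function.update f (n + 1) w t = f t := fun t ht =>
      Function.update_of_ne (by omega) _ _
    refine ⟨Function.update f (n + 1) w, ?_, ?_, ?_, ?_, ?_⟩
    · rw [old 0 (by omega), h0]
    · simp
    · exact old n le_rfl
    · intro t ht
      rcases Nat.lt_succ_iff_lt_or_eq.1 ht with ht | rfl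
      · rw [old t (by omega), old (t + 1) (by omega)]
        exact hadj t ht
      · rw [old t le_rfl, Function.update_self]
        exact hw
    · intro t ht0 ht
      unfold ColliderAt
      rw [old t (by omega), old (t - 1) (by omega)]
      rcases Nat.lt_succ_iff_lt_or_eq.1 ht with ht | rfl
      · rw [old (t + 1) (by omega)]
        exact hd t ht0 ht
      · rw [Function.update_self]
        exact ⟨fun h => .inr ((hn ht0).1 h), (hn ht0).2⟩
  induction h with
  | refl => exact ⟨0, fun _ => i, rfl, rfl, by simp, fun t h0 h => by omega, by simp, by simp⟩
  | forward _ hv hvw ih =>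
    obtain ⟨n, f, h0, rfl, hadj, hd, -, -⟩ := ih
    obtain ⟨g, hg0, hgw, hgn, hgadj, hgd⟩ := extend n f _ h0 hadj hd (.inl hvw)
      fun _ => ⟨fun h => absurd h.2 (hG.asymm_s8 hvw), fun _ => hv⟩
    exact ⟨n + 1, g, hg0, hgw, hgadj, hgd, by simpa [hgw, hgn] using hvw, by simp⟩
  | backward _ hv hwv ih =>
    obtain ⟨n, f, h0, rfl, hadj, hd, -, hb⟩ := ih
    obtain ⟨g, hg0, hgw, hgn, hgadj, hgd⟩ := extend n f _ h0 hadj hd (.inr hwv)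
      fun hn => ⟨fun h => absurd h.1 (hG.asymm_s8 (hb rfl hn)), fun _ => hv⟩
    exact ⟨n + 1, g, hg0, hgw, hgadj, hgd, by simp, by simpa [hgw, hgn] using hwv⟩
  | collider _ hv hwv ih =>
    obtain ⟨n, f, h0, rfl, hadj, hd, hb, -⟩ := ih
    obtain ⟨g, hg0, hgw, hgn, hgadj, hgd⟩ := extend n f _ h0 hadj hd (.inr hwv)
      fun _ => ⟨fun _ => hv, fun h => absurd ⟨(hb rfl).2, hwv⟩ h⟩
    exact ⟨n + 1, g, hg0, hgw, hgadj, hgd, by simp, by simpa [hgw, hgn] using hwv⟩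

lemma ancOf_of_closed_walk (hG : Acyclic G) {n : ℕ} {f : ℕ → V}
    (hadj : ∀ t, t < n → Adj G (f t) (f (t + 1))) (hd : DConn G n f C) {s u : ℕ}
    (hsu : s < u) (hun : u ≤ n) (heq : f s = f u) (hout : G (f s) (f (s + 1))) :
    AncOf G C (f s) := by
  by_contra hC
  have key : ∀ t, s < t → t ≤ u → G (f (t - 1)) (f t) ∧ Relation.TransGen G (f s) (f t) := by
    intro t hst
    induction t, hst using Nat.le_induction with
    | base => exact fun _ => ⟨hout, .single hout⟩
    | succ t hst ih =>
      intro htu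
      obtain ⟨hin, htr⟩ := ih (by omega)
      rcases hadj t (by omega) with h | h
      · exact ⟨h, htr.tail h⟩
      · exact absurd (.of_desc htr.to_reflTransGen
          (hd.ancOf (by omega) (by omega) ⟨hin, h⟩)) hC
  exact hG (f s) (by simpa [← heq] using (key u hsu le_rfl).2)

lemma exists_path_of_walk (hG : Acyclic G) {j : V} (hij : i ≠ j) (n : ℕ) (f : ℕ → V)
    (h0 : f 0 = i) (hn : f n = j) (hadj : ∀ t, t < n → Adj G (f t) (f (t + 1)))
    (hd : DConn G n f C) : ∃ m g, IsPath G m g i j ∧ DConn G m g C := by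
  induction n using Nat.strong_induction_on generalizing f with
  | _ n ih =>
  by_cases hinj : ∀ s t, s ≤ n → t ≤ n → f s = f t → s = t
  · refine ⟨n, f, ⟨Nat.pos_of_ne_zero ?_, h0, hn, hinj, hadj⟩, hd⟩
    rintro rfl
    exact hij (h0.symm.trans hn)
  obtain ⟨s, u, hsu, hun, heq⟩ : ∃ s u, s < u ∧ u ≤ n ∧ f s = f u := by
    push Not at hinj
    obtain ⟨s, t, hs, ht, heq, hne⟩ := hinj
    rcases lt_or_gt_of_ne hne with h | h
    · exact ⟨s, t, h, ht, heq⟩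
    · exact ⟨t, s, h, hs, heq.symm⟩
  obtain ⟨k, rfl⟩ := Nat.exists_eq_add_of_lt hsu
  set g : ℕ → V := fun t => if t ≤ s then f t else f (t + (k + 1)) with hg
  have g_le : ∀ t, t ≤ s → g t = f t := fun t ht => if_pos ht
  have g_ge : ∀ t, s ≤ t → g t = f (t + (k + 1)) := by
    intro t ht
    rcases ht.eq_or_lt with rfl | ht
    · rw [g_le s le_rfl, heq, add_assoc]
    · exact if_neg (by omega)
  refine ih (n - (k + 1)) (by omega) g (by rw [g_le 0 (by omega), h0]) ?_ ?_ ?_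
  · rw [g_ge _ (by omega), ← hn]
    congr 1
    omega
  · intro t ht
    rcases lt_or_ge t s with hts | hts
    · rw [g_le t (by omega), g_le (t + 1) (by omega)]
      exact hadj t (by omega)
    · rw [g_ge t hts, g_ge (t + 1) (by omega), add_right_comm]
      exact hadj _ (by omega)
  · intro t ht0 ht
    rcases lt_trichotomy t s with hts | rfl | hts
    · unfold ColliderAt
      rw [g_le t (by omega), g_le (t + 1) (by omega), g_le (t - 1) (by omega)]
      exact hd t ht0 (by omega)
    · have e1 : g (t - 1) = f (t - 1) := g_le _ (by omega)
      have e2 : g t = f t := g_le _ le_rfl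
      have e3 : g (t + 1) = f (t + k + 1 + 1) := by
        rw [g_ge _ (by omega)]
        congr 1
        omega
      unfold ColliderAt
      rw [e1, e2, e3]
      constructor
      · intro hcol
        right
        rcases hadj t (by omega) with hout | hin
        · exact ancOf_of_closed_walk hG hadj hd hsu hun heq hout
        · exact hd.ancOf ht0 (by omega) ⟨hcol.1, hin⟩
      · intro hcol
        by_cases h1 : G (f (t - 1)) (f t)
        · rw [heq]
          refine (hd (t + k + 1) (by omega) (by omega)).2 fun h => hcol ⟨h1, ?_⟩
          rw [heq]
          exact h.2
        · exact (hd t ht0 (by omega)).2 fun h => h1 h.1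
    · have e1 : g (t - 1) = f (t + (k + 1) - 1) := by
        rw [g_ge _ (by omega)]
        congr 1
        omega
      have e2 : g t = f (t + (k + 1)) := g_ge _ (by omega)
      have e3 : g (t + 1) = f (t + (k + 1) + 1) := by
        rw [g_ge _ (by omega)]
        congr 1
        omega
      unfold ColliderAt
      rw [e1, e2, e3]
      exact hd _ (by omega) (by omega)

lemma DSep.not_openWalk (hG : Acyclic G) {j : V} (hij : i ≠ j) (h : DSep G i j C) (b : Bool) :
    ¬ OpenWalk G C i j b := by
  intro hw
  obtain ⟨n, f, h0, hn, hadj, hd, -, -⟩ := hw.exists_fun hG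
  obtain ⟨m, g, hp, hg⟩ := exists_path_of_walk hG hij n f h0 hn hadj hd
  exact h m g hp hg

end Walks

section Ancestral

/-- A set of vertices is ancestral if it is closed under taking parents. -/
def Ancestral (G : V → V → Prop) (A : Finset V) : Prop :=
  ∀ ⦃k l⦄, G k l → l ∈ A → k ∈ A

variable {G : V → V → Prop}

lemma Ancestral.mem_of_desc {A : Finset V} (hA : Ancestral G A) {v w : V} (h : Desc G v w)
    (hw : w ∈ A) : v ∈ A := by
  induction h using Relation.ReflTransGen.head_induction_on with
  | refl => exact hw
  | head hvw _ ih => exact hA hvw ih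

lemma Acyclic.wellFounded_s8 [Finite V] (hG : Acyclic G) : WellFounded G := by
  have : IsTrans V (Relation.TransGen G) := ⟨fun _ _ _ => Relation.TransGen.trans⟩
  have : Std.Irrefl (Relation.TransGen G) := ⟨hG⟩
  exact Subrelation.wf Relation.TransGen.single
    (Finite.wellFounded_of_trans_of_irrefl (Relation.TransGen G))

/-- Every ancestral set is obtained from the full vertex set by removing sinks one at a time. -/
lemma ancestral_induction [Fintype V] [DecidableEq V] (hG : Acyclic G) {p : Finset V → Prop}
    (univ : p Finset.univ)
    (step : ∀ A i, Ancestral G A → i ∉ A → (∀ k, G k i → k ∈ A) → p (insert i A) → p A)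
    (A : Finset V) (hA : Ancestral G A) : p A := by
  induction hc : Aᶜ.card using Nat.strong_induction_on generalizing A with
  | _ n ih =>
  subst hc
  by_cases h : A = Finset.univ
  · exact h ▸ univ
  obtain ⟨x, hx⟩ : ∃ x, x ∉ A := by simpa [Finset.eq_univ_iff_forall] using h
  obtain ⟨i, hi, hmin⟩ := hG.wellFounded_s8.has_min {x | x ∉ A} ⟨x, hx⟩
  have hpa : ∀ k, G k i → k ∈ A := fun k hk => by_contra fun hkA => hmin k hkA hk
  refine step A i hA hi hpa (ih _ (Finset.card_lt_card ?_) _ ?_ rfl)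
  · exact Finset.compl_ssubset_compl.2 (Finset.ssubset_insert hi)
  · intro k l hkl hl
    rcases Finset.mem_insert.1 hl with rfl | hl
    · exact Finset.mem_insert_of_mem (hpa k hkl)
    · exact Finset.mem_insert_of_mem (hA hkl hl)

/-- A vertex is d-separated from any non-descendant `k` given a set of non-descendants that
contains all its parents. -/
lemma dSep_of_parents_subset (hG : Acyclic G) {A D : Finset V} (hA : Ancestral G A) {i k : V}
    (hi : i ∉ A) (hk : k ∈ A) (hkD : k ∉ D) (hDA : D ⊆ A) (hpa : ∀ l, G l i → l ∈ D) :
    DSep G i k D := by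
  rintro n f ⟨hn, rfl, rfl, -, hadj⟩ hd
  have key : ∀ t, t < n → G (f t) (f (t + 1)) ∧ Desc G (f 0) (f (t + 1)) := by
    intro t
    induction t with
    | zero =>
      intro _
      rcases hadj 0 hn with h | h
      · exact ⟨h, .single h⟩
      · have h1 := hpa _ h
        have hn1 : n ≠ 1 := by
          rintro rfl
          exact hkD h1
        exact absurd h1 ((hd 1 one_pos (by omega)).2 fun hc => hG.asymm_s8 h hc.1)
    | succ t ih =>
      intro ht
      obtain ⟨hin, hdesc⟩ := ih (by omega)
      rcases hadj (t + 1) ht with h | h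
      · exact ⟨h, hdesc.tail h⟩
      · obtain ⟨d, hd', hdd⟩ := hd.ancOf (t := t + 1) (by omega) ht ⟨hin, h⟩
        exact absurd (hA.mem_of_desc (hdesc.trans hdd) (hDA hd')) hi
  have := (key (n - 1) (by omega)).2
  rw [Nat.sub_add_cancel hn] at this
  exact hi (hA.mem_of_desc this hk)

end Ancestral

section Margins

variable {P : (∀ i, 𝒳 i) → ℝ}

lemma IsPMF.margin_nonneg (hP : IsPMF P) (S : Finset (Fin p)) (x : ∀ i, 𝒳 i) :
    0 ≤ margin P S x :=
  Finset.sum_nonneg fun y _ => by split_ifs <;> simp [hP.1 y]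

lemma IsPMF.margin_anti (hP : IsPMF P) {S T : Finset (Fin p)} (h : S ⊆ T) (x : ∀ i, 𝒳 i) :
    margin P T x ≤ margin P S x := by
  refine Finset.sum_le_sum fun y _ => ?_
  by_cases hT : ∀ i ∈ T, y i = x i
  · rw [if_pos hT, if_pos fun i hi => hT i (h hi)]
  · rw [if_neg hT]
    split_ifs <;> simp [hP.1 y]

lemma IsPMF.margin_eq_zero (hP : IsPMF P) {S T : Finset (Fin p)} (h : S ⊆ T) {x : ∀ i, 𝒳 i}
    (hS : margin P S x = 0) : margin P T x = 0 :=
  le_antisymm (hS ▸ hP.margin_anti h x) (hP.margin_nonneg T x)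

lemma IsPMF.margin_empty (hP : IsPMF P) (x : ∀ i, 𝒳 i) : margin P ∅ x = 1 := by
  simpa [margin] using hP.2

lemma margin_univ (x : ∀ i, 𝒳 i) : margin P Finset.univ x = P x := by
  unfold margin
  rw [Finset.sum_eq_single x (fun y _ hy => if_neg fun h => hy (funext fun i => h i (by simp)))
    (by simp)]
  exact if_pos fun _ _ => rfl

lemma dependsOn_margin (S : Finset (Fin p)) : DependsOn (margin P S) (S : Set (Fin p)) := by
  intro x y h
  refine Finset.sum_congr rfl fun z _ => ?_
  classical
  exact if_congr (forall₂_congr fun i hi => by rw [h i hi]) rfl rfl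

lemma sum_margin_insert {S : Finset (Fin p)} {a : Fin p} (ha : a ∉ S) (x : ∀ i, 𝒳 i) :
    ∑ b, margin P (insert a S) (Function.update x a b) = margin P S x := by
  classical
  unfold margin
  rw [Finset.sum_comm]
  refine Finset.sum_congr rfl fun y _ => ?_
  have : ∀ b, (∀ i ∈ insert a S, y i = Function.update x a b i) ↔
      (b = y a ∧ ∀ i ∈ S, y i = x i) := by
    intro b
    rw [Finset.forall_mem_insert, Function.update_self, eq_comm]
    refine and_congr_right fun _ => forall₂_congr fun i hi => ?_
    rw [Function.update_of_ne (by rintro rfl; exact ha hi)]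
  simp only [this, ite_and]
  simp

end Margins

section DependsOn

lemma _root_.DependsOn.update_eq {ι β : Type*} [DecidableEq ι] {α : ι → Type*} {F : (∀ i, α i) → β}
    {s : Set ι} (hF : DependsOn F s) {a : ι} (ha : a ∉ s) (x : ∀ i, α i) (b : α a) :
    F (Function.update x a b) = F x :=
  hF fun i hi => Function.update_of_ne (by rintro rfl; exact ha hi) _ _

lemma _root_.DependsOn.sum_update {ι β : Type*} [DecidableEq ι] [AddCommMonoid β] {α : ι → Type*}
    {F : (∀ i, α i) → β} {s t : Set ι} (hF : DependsOn F s) {a : ι} [Fintype (α a)]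
    (hst : ∀ i ∈ s, i ≠ a → i ∈ t) :
    DependsOn (fun x => ∑ b, F (Function.update x a b)) t := by
  intro x y h
  refine Finset.sum_congr rfl fun b _ => hF fun i hi => ?_
  by_cases hia : i = a
  · subst hia
    simp
  · simp [hia, h i (hst i hi hia)]

end DependsOn

section Splitting

variable {P : (∀ i, 𝒳 i) → ℝ}

/-- The marginal on `A` is a product of a function of the coordinates in `S ∪ C` and a function
of the coordinates outside `S`. -/
def MarginSplits (P : (∀ i, 𝒳 i) → ℝ) (S : Set (Fin p)) (C A : Finset (Fin p)) : Prop :=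
  ∃ F K : (∀ i, 𝒳 i) → ℝ, (∀ x, margin P A x = F x * K x) ∧
    DependsOn F {v | v ∈ A ∧ (v ∈ S ∨ v ∈ C)} ∧ DependsOn K {v | v ∈ A ∧ v ∉ S}

lemma MarginSplits.of_insert {S : Set (Fin p)} {C A : Finset (Fin p)} {a : Fin p} (ha : a ∉ A)
    (hC : a ∉ C) (h : MarginSplits P S C (insert a A)) : MarginSplits P S C A := by
  obtain ⟨F, K, hFK, hF, hK⟩ := h
  by_cases haS : a ∈ S
  · refine ⟨fun x => ∑ b, F (Function.update x a b), K, fun x => ?_, hF.sum_update ?_,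
      hK.mono ?_⟩
    · rw [← sum_margin_insert ha x, Finset.sum_mul]
      refine Finset.sum_congr rfl fun b _ => ?_
      rw [hFK, hK.update_eq (by simp [haS])]
    · rintro v ⟨hv, hv'⟩ hva
      exact ⟨Finset.mem_of_mem_insert_of_ne hv hva, hv'⟩
    · rintro v ⟨hv, hv'⟩
      exact ⟨Finset.mem_of_mem_insert_of_ne hv (by rintro rfl; exact hv' haS), hv'⟩
  · refine ⟨F, fun x => ∑ b, K (Function.update x a b), fun x => ?_, hF.mono ?_,
      hK.sum_update ?_⟩
    · rw [← sum_margin_insert ha x, Finset.mul_sum]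
      refine Finset.sum_congr rfl fun b _ => ?_
      rw [hFK, hF.update_eq (by simp [haS, hC])]
    · rintro v ⟨hv, hv'⟩
      exact ⟨Finset.mem_of_mem_insert_of_ne hv (by rintro rfl; tauto), hv'⟩
    · rintro v ⟨hv, hv'⟩ hva
      exact ⟨Finset.mem_of_mem_insert_of_ne hv hva, hv'⟩

lemma MarginSplits.mono {S : Set (Fin p)} {C A B : Finset (Fin p)} (hCB : C ⊆ B) (hBA : B ⊆ A)
    (h : MarginSplits P S C A) : MarginSplits P S C B := by
  suffices ∀ D : Finset (Fin p), MarginSplits P S C (D ∪ B) → MarginSplits P S C B by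
    exact this A (by rwa [Finset.union_eq_left.2 hBA])
  intro D
  induction D using Finset.induction_on with
  | empty => simp
  | insert a D _ ih =>
    intro h
    rw [Finset.insert_union] at h
    by_cases ha : a ∈ D ∪ B
    · exact ih (by rwa [Finset.insert_eq_of_mem ha] at h)
    · exact ih (h.of_insert ha fun hc => ha (Finset.mem_union_right _ (hCB hc)))

lemma MarginSplits.condIndep {S : Set (Fin p)} {C A : Finset (Fin p)} {i j : Fin p}
    (hA : insert i (insert j C) ⊆ A) (hi : i ∈ S) (hj : j ∉ S) (hiC : i ∉ C) (hjC : j ∉ C)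
    (h : MarginSplits P S C A) : CondIndep P {i} {j} C := by
  have hij : i ≠ j := by
    rintro rfl
    exact hj hi
  obtain ⟨F, K, hFK, hF, hK⟩ := h.mono (by grind) hA
  intro x
  have hj' : ∀ y, margin P (insert j C) y = (∑ b, F (Function.update y i b)) * K y := by
    intro y
    rw [← sum_margin_insert (by grind : i ∉ insert j C) y, Finset.sum_mul]
    refine Finset.sum_congr rfl fun b _ => ?_
    rw [hFK, hK.update_eq (by simp [hi])]
  have hi' : margin P (insert i C) x = F x * ∑ b, K (Function.update x j b) := by
    rw [← sum_margin_insert (by grind : j ∉ insert i C) x, Finset.mul_sum, Finset.insert_comm]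
    refine Finset.sum_congr rfl fun b _ => ?_
    rw [hFK, hF.update_eq (by simp [hj, hjC])]
  have hF' : DependsOn (fun y => ∑ b, F (Function.update y i b)) (C : Set (Fin p)) := by
    refine hF.sum_update ?_
    rintro v ⟨hv, hv'⟩ hvi
    have : v ≠ j := by
      rintro rfl
      tauto
    simpa [hvi, this] using hv
  have hC' : margin P C x =
      (∑ b, F (Function.update x i b)) * ∑ b, K (Function.update x j b) := by
    rw [← sum_margin_insert hjC x, Finset.mul_sum]
    refine Finset.sum_congr rfl fun b _ => ?_
    rw [hj', hF'.update_eq (by simpa using hjC)]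
  have e : ({i} ∪ {j} ∪ C : Finset (Fin p)) = insert i (insert j C) := by
    ext
    simp
  rw [e, ← Finset.insert_eq, ← Finset.insert_eq, hFK, hj', hi', hC']
  ring

end Splitting

section Factorization

variable {P : (∀ i, 𝒳 i) → ℝ} {G : Fin p → Fin p → Prop}

lemma margin_eq_prod_of_ancestral (hG : Acyclic G) {φ : Fin p → (∀ i, 𝒳 i) → ℝ}
    (hloc : ∀ i x y, x i = y i → (∀ k, G k i → x k = y k) → φ i x = φ i y)
    (hsum : ∀ i x, ∑ a : 𝒳 i, φ i (Function.update x i a) = 1)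
    (hprod : ∀ x, P x = ∏ i, φ i x) (A : Finset (Fin p)) (hA : Ancestral G A) :
    ∀ x, margin P A x = ∏ i ∈ A, φ i x := by
  refine ancestral_induction hG (p := fun A => ∀ x, margin P A x = ∏ i ∈ A, φ i x) ?_ ?_ A hA
  · intro x
    rw [margin_univ, hprod]
  · intro A i hA hi _ ih x
    have : ∀ k ∈ A, ∀ b, φ k (Function.update x i b) = φ k x := by
      intro k hk b
      refine hloc _ _ _ (Function.update_of_ne ?_ _ _) fun l hl => Function.update_of_ne ?_ _ _
      · rintro rfl
        exact hi hk
      · rintro rfl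
        exact hi (hA hl hk)
    rw [← sum_margin_insert hi x]
    simp_rw [ih, Finset.prod_insert hi]
    calc ∑ b, φ i (Function.update x i b) * ∏ k ∈ A, φ k (Function.update x i b)
        = ∑ b, φ i (Function.update x i b) * ∏ k ∈ A, φ k x :=
          Finset.sum_congr rfl fun b _ => by
            rw [Finset.prod_congr rfl fun k hk => this k hk b]
      _ = ∏ k ∈ A, φ k x := by rw [← Finset.sum_mul, hsum, one_mul]

lemma marginSplits_of_closed {φ : Fin p → (∀ i, 𝒳 i) → ℝ} {H C : Finset (Fin p)}
    {S : Set (Fin p)} (hH : Ancestral G H)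
    (hloc : ∀ i x y, x i = y i → (∀ k, G k i → x k = y k) → φ i x = φ i y)
    (hprod : ∀ x, margin P H x = ∏ i ∈ H, φ i x)
    (hS : ∀ k ∈ H, ∀ a b, (a = k ∨ G a k) → (b = k ∨ G b k) → a ∈ S → b ∉ C → b ∈ S) :
    MarginSplits P S C H := by
  classical
  refine ⟨fun x => ∏ k ∈ H with ∃ a, (a = k ∨ G a k) ∧ a ∈ S, φ k x,
    fun x => ∏ k ∈ H with ¬ ∃ a, (a = k ∨ G a k) ∧ a ∈ S, φ k x, fun x => ?_, ?_, ?_⟩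
  · rw [hprod, Finset.prod_filter_mul_prod_filter_not]
  · intro x y h
    refine Finset.prod_congr rfl fun k hk => ?_
    obtain ⟨hk, a, ha, haS⟩ := Finset.mem_filter.1 hk
    have key : ∀ b, (b = k ∨ G b k) → x b = y b := fun b hb =>
      h b ⟨hb.elim (fun e => e ▸ hk) fun e => hH e hk,
        or_iff_not_imp_right.2 (hS k hk a b ha hb haS)⟩
    exact hloc _ _ _ (key k (.inl rfl)) fun l hl => key l (.inr hl)
  · intro x y h
    refine Finset.prod_congr rfl fun k hk => ?_
    obtain ⟨hk, hno⟩ := Finset.mem_filter.1 hk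
    have key : ∀ b, (b = k ∨ G b k) → x b = y b := fun b hb =>
      h b ⟨hb.elim (fun e => e ▸ hk) fun e => hH e hk, fun hbS => hno ⟨b, hb, hbS⟩⟩
    exact hloc _ _ _ (key k (.inl rfl)) fun l hl => key l (.inr hl)

lemma Factorizes.isIMAP (hG : Acyclic G) (h : Factorizes G P) : IsIMAP G P := by
  classical
  obtain ⟨φ, -, hloc, hsum, hprod⟩ := h
  intro i j C hij hi hj hsep
  let H : Finset (Fin p) := {v | AncOf G (insert i (insert j C)) v}
  have memH : ∀ v, v ∈ H ↔ AncOf G (insert i (insert j C)) v := by simp [H]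
  have hH : Ancestral G H := fun k l hkl hl =>
    (memH k).2 (.of_desc (.single hkl) ((memH l).1 hl))
  have hsub : insert i (insert j C) ⊆ H := fun v hv => (memH v).2 (.of_mem hv)
  let S : Set (Fin p) := {v | v ∉ C ∧ ∃ b, OpenWalk G C i v b}
  have back : ∀ {v w b}, OpenWalk G C i v b → (b = false → v ∉ C) → v ∈ H → G w v →
      OpenWalk G C i w false := by
    intro v w b hw hvC hv hwv
    cases b with
    | false => exact hw.backward (hvC rfl) hwv
    | true =>
      rcases hw.backward_or_reach ((memH v).1 hv) hwv with h | ⟨b, hb⟩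
      · exact h
      · exact absurd hb (hsep.not_openWalk hG hij b)
  have hiS : i ∈ S := ⟨hi, false, .refl⟩
  have hjS : j ∉ S := fun h => h.2.elim (hsep.not_openWalk hG hij)
  refine (marginSplits_of_closed hH hloc
    (margin_eq_prod_of_ancestral hG hloc hsum hprod H hH) ?_).condIndep hsub hiS hjS hi hj
  rintro k hk a b ha hb ⟨haC, c, hc⟩ hbC
  refine ⟨hbC, ?_⟩
  rcases ha with rfl | ha <;> rcases hb with rfl | hb
  · exact ⟨c, hc⟩
  · exact ⟨false, back hc (fun _ => haC) hk hb⟩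
  · exact ⟨true, hc.forward haC ha⟩
  · exact ⟨false, back (hc.forward haC ha) (by simp) hk hb⟩

lemma IsIMAP.margin_insert_mul (hG : Acyclic G) (hP : IsPMF P) (h : IsIMAP G P)
    {A Q : Finset (Fin p)} {i : Fin p} (hA : Ancestral G A) (hi : i ∉ A)
    (hQ : ∀ k, k ∈ Q ↔ G k i) (hQA : Q ⊆ A) (x : ∀ i, 𝒳 i) :
    margin P (insert i A) x * margin P Q x = margin P A x * margin P (insert i Q) x := by
  suffices ∀ D, D ⊆ A → margin P (insert i (D ∪ Q)) x * margin P Q x =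
      margin P (D ∪ Q) x * margin P (insert i Q) x by
    simpa [Finset.union_eq_left.2 hQA] using this A subset_rfl
  intro D
  induction D using Finset.induction_on with
  | empty =>
    intro _
    rw [Finset.empty_union, mul_comm]
  | insert k D hkD ih =>
    intro hD
    obtain ⟨hk, hD⟩ := Finset.insert_subset_iff.1 hD
    specialize ih hD
    rw [Finset.insert_union]
    by_cases hkQ : k ∈ D ∪ Q
    · rwa [Finset.insert_eq_of_mem hkQ]
    have hDQ : D ∪ Q ⊆ A := Finset.union_subset hD hQA
    have hsep := dSep_of_parents_subset hG hA hi hk hkQ hDQ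
      fun l hl => Finset.mem_union_right _ ((hQ l).2 hl)
    have hci := h i k (D ∪ Q) (by rintro rfl; exact hi hk) (fun hm => hi (hDQ hm)) hkQ hsep x
    have e : ({i} ∪ {k} ∪ (D ∪ Q) : Finset (Fin p)) = insert i (insert k (D ∪ Q)) := by
      ext
      simp
    rw [e, ← Finset.insert_eq, ← Finset.insert_eq] at hci
    by_cases h0 : margin P (D ∪ Q) x = 0
    · rw [hP.margin_eq_zero (Finset.subset_insert _ _) h0,
        hP.margin_eq_zero ((Finset.subset_insert k _).trans (Finset.subset_insert i _)) h0]
      simp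
    · refine mul_left_cancel₀ h0 ?_
      linear_combination margin P Q x * hci + margin P (insert k (D ∪ Q)) x * ih

lemma IsIMAP.factorizes [∀ i, Nonempty (𝒳 i)] (hG : Acyclic G) (hP : IsPMF P)
    (h : IsIMAP G P) : Factorizes G P := by
  classical
  let pa : Fin p → Finset (Fin p) := fun i => {k | G k i}
  have mem_pa : ∀ i k, k ∈ pa i ↔ G k i := by simp [pa]
  have hpa : ∀ i, i ∉ pa i := fun i hi => hG i (.single ((mem_pa i i).1 hi))
  let φ : Fin p → (∀ i, 𝒳 i) → ℝ := fun i x =>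
    if margin P (pa i) x = 0 then (Fintype.card (𝒳 i) : ℝ)⁻¹
    else margin P (insert i (pa i)) x / margin P (pa i) x
  refine ⟨φ, fun i x => ?_, fun i x y hi hk => ?_, fun i x => ?_, ?_⟩
  · dsimp only [φ]
    split_ifs
    · positivity
    · exact div_nonneg (hP.margin_nonneg _ _) (hP.margin_nonneg _ _)
  · have h1 : margin P (pa i) x = margin P (pa i) y :=
      dependsOn_margin _ fun k hk' => hk k ((mem_pa i k).1 hk')
    have h2 : margin P (insert i (pa i)) x = margin P (insert i (pa i)) y := by
      refine dependsOn_margin _ fun k hk' => ?_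
      rcases Finset.mem_insert.1 hk' with rfl | hk'
      · exact hi
      · exact hk k ((mem_pa i k).1 hk')
    simp only [φ, h1, h2]
  · have : ∀ a, margin P (pa i) (Function.update x i a) = margin P (pa i) x :=
      (dependsOn_margin _).update_eq (hpa i) x
    simp only [φ, this]
    split_ifs with h0
    · simp
    · rw [← Finset.sum_div, sum_margin_insert (hpa i), div_self h0]
  · have step : ∀ A i, Ancestral G A → i ∉ A → (∀ k, G k i → k ∈ A) →
        ∀ x, margin P (insert i A) x = φ i x * margin P A x := by
      intro A i hA hi hpaA x
      have hsub : pa i ⊆ A := fun k hk => hpaA k ((mem_pa i k).1 hk)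
      dsimp only [φ]
      split_ifs with h0
      · rw [hP.margin_eq_zero hsub h0,
          hP.margin_eq_zero (hsub.trans (Finset.subset_insert i A)) h0, mul_zero]
      · rw [div_mul_eq_mul_div, eq_div_iff h0,
          h.margin_insert_mul hG hP hA hi (mem_pa i) hsub x, mul_comm]
    have := ancestral_induction hG
      (p := fun A => (∀ x, margin P A x = ∏ i ∈ A, φ i x) → ∀ x, P x = ∏ i, φ i x)
      (fun h x => by rw [← margin_univ (P := P) x, h])
      (fun A i hA hi hpaA ih h => ih fun x => by
        rw [step A i hA hi hpaA, Finset.prod_insert hi, h])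
      ∅ (fun _ _ _ => by simp)
    exact this fun x => by rw [hP.margin_empty, Finset.prod_empty]

end Factorization

/-- **Equivalence of the Markov factorization property and the global Markov
property.** A pmf `P` factorizes according to a DAG `G` on `Fin p` if and only if
`P` satisfies the global Markov property with respect to `G`. -/
theorem factorizes_iff_globalMarkov (G : Fin p → Fin p → Prop) (hG : Acyclic G)
    (P : (∀ i, 𝒳 i) → ℝ) [∀ i, Nonempty (𝒳 i)] (hP : IsPMF P) :
    Factorizes G P ↔ IsIMAP G P := by
  exact ⟨fun h => h.isIMAP hG, fun h => h.factorizes hG hP⟩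

end CausalDiscovery
end

section
/- (Completeness of d-separation.) Let G be a DAG on Fin p and let (i, j, C) be a triple with i ≠ j, C ⊆ Fin p \ {i,j}, such that i and j are d-connected given C in G. Then there exists a probability mass function P on {0,1}^p that factorizes according to G and under which X_i and X_j are NOT conditionally independent given X_C. -/
namespace CausalDiscovery

variable {V : Type*}

variable {p : ℕ} {𝒳 : Fin p → Type*} [∀ i, Fintype (𝒳 i)]

/-- A move of a d-connecting walk from `v` to `w`. The flag `b` records whether the walk
entered `v` along an edge pointing into `v`, and `b'` does the same for `w`. Passing a
collider costs `K`, every other move costs `1`. -/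
def WalkStep (E : V → V → Prop) (C : Finset V) (K : ℕ) (v : V) (b : Bool) (w : V) (b' : Bool)
    (c : ℕ) : Prop :=
  (b' = true ∧ E v w ∧ v ∉ C ∧ c = 1) ∨
  (b' = false ∧ b = false ∧ E w v ∧ v ∉ C ∧ c = 1) ∨
  (b' = false ∧ b = true ∧ E w v ∧ (∃ z ∈ C, Desc E v z) ∧ c = K)

/-- `Reach E C K i n v b`: a d-connecting walk of cost `n` leads from `i` to `v`. -/
inductive Reach (E : V → V → Prop) (C : Finset V) (K : ℕ) (i : V) : ℕ → V → Bool → Prop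
  | start : Reach E C K i 0 i false
  | step {n c : ℕ} {v w : V} {b b' : Bool} : Reach E C K i n v b →
      WalkStep E C K v b w b' c → Reach E C K i (n + c) w b'

/-- `v 0, …, v N` is a cheapest d-connecting walk from `i` to `j`; `d t` is the cost of
its first `t` moves. -/
structure CheapestWalk (E : V → V → Prop) (C : Finset V) (K : ℕ) (i j : V) (N : ℕ)
    (v : ℕ → V) (b : ℕ → Bool) (d : ℕ → ℕ) : Prop where
  v_zero : v 0 = i
  b_zero : b 0 = false
  v_last : v N = j
  step : ∀ t < N, ∃ c, WalkStep E C K (v t) (b t) (v (t + 1)) (b (t + 1)) c ∧ d (t + 1) = d t + c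
  reach : ∀ t ≤ N, Reach E C K i (d t) (v t) (b t)
  le_of_reach : ∀ t ≤ N, ∀ n, Reach E C K i n (v t) (b t) → d t ≤ n
  last_le_of_reach : ∀ a n, Reach E C K i n j a → d N ≤ n

theorem Reach.exists_walk {E : V → V → Prop} {C : Finset V} {K : ℕ} {i w : V} {n : ℕ} {a : Bool}
    (h : Reach E C K i n w a) :
    ∃ (N : ℕ) (v : ℕ → V) (b : ℕ → Bool) (d : ℕ → ℕ),
      v 0 = i ∧ b 0 = false ∧ d 0 = 0 ∧ v N = w ∧ b N = a ∧ d N = n ∧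
      ∀ t < N, ∃ c, WalkStep E C K (v t) (b t) (v (t + 1)) (b (t + 1)) c ∧
        d (t + 1) = d t + c := by
  induction h with
  | start => exact ⟨0, fun _ => i, fun _ => false, fun _ => 0, by simp⟩
  | @step n c u w a a' _ hs ih =>
    obtain ⟨N, v, b, d, hv0, hb0, hd0, hvN, hbN, hdN, hstep⟩ := ih
    refine ⟨N + 1, fun t => if t ≤ N then v t else w, fun t => if t ≤ N then b t else a',
      fun t => if t ≤ N then d t else n + c, by simpa, by simpa, by simpa, by simp, by simp,
      by simp, fun t ht => ?_⟩
    rcases Nat.lt_succ_iff_lt_or_eq.mp ht with h | rfl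
    · have h1 : t ≤ N := h.le
      have h2 : t + 1 ≤ N := h
      simpa [h1, h2] using hstep t h
    · exact ⟨c, by simpa [hvN, hbN] using hs, by simp [hdN]⟩

theorem exists_cheapestWalk {E : V → V → Prop} {C : Finset V} {K : ℕ} {i j : V}
    (h : ∃ n a, Reach E C K i n j a) : ∃ N v b d, CheapestWalk E C K i j N v b d := by
  classical
  obtain ⟨a, hr⟩ := Nat.find_spec h
  obtain ⟨N, v, b, d, hv0, hb0, hd0, hvN, hbN, hdN, hstep⟩ := hr.exists_walk
  have hlast : ∀ a n, Reach E C K i n j a → d N ≤ n := fun a n hn =>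
    hdN ▸ Nat.find_min' h ⟨a, hn⟩
  have hreach : ∀ t ≤ N, Reach E C K i (d t) (v t) (b t) := by
    intro t
    induction t with
    | zero => intro _; rw [hv0, hb0, hd0]; exact .start
    | succ t ih =>
      intro ht
      obtain ⟨c, hc, hd⟩ := hstep t ht
      rw [hd]
      exact (ih (by omega)).step hc
  have hshift : ∀ t, ∀ n, ∀ r, t + r ≤ N → Reach E C K i n (v t) (b t) →
      ∃ m, Reach E C K i m (v (t + r)) (b (t + r)) ∧ m + d t = n + d (t + r) := by
    intro t n r
    induction r with
    | zero => exact fun _ hn => ⟨n, hn, rfl⟩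
    | succ r ih =>
      intro hr hn
      obtain ⟨m, hm, hmn⟩ := ih (by omega) hn
      obtain ⟨c, hc, hd⟩ := hstep (t + r) (by omega)
      refine ⟨m + c, hm.step hc, ?_⟩
      rw [← Nat.add_assoc t r 1, hd]
      omega
  refine ⟨N, v, b, d, hv0, hb0, hvN, hstep, hreach, fun t ht n hn => ?_, hlast⟩
  obtain ⟨m, hm, hmn⟩ := hshift t n (N - t) (by omega) hn
  rw [Nat.add_sub_cancel' ht] at hm hmn
  have := hlast _ _ (hvN ▸ hm)
  omega

/-- A d-connecting path gives a d-connecting walk. -/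
theorem exists_reach_of_not_dsep {E : V → V → Prop} {C : Finset V} {i j : V}
    (K : ℕ) (hE : ∀ a b, E a b → ¬ E b a) (hiC : i ∉ C) (h : ¬ DSep E i j C) :
    ∃ n a, Reach E C K i n j a := by
  simp only [DSep, not_forall, not_not] at h
  obtain ⟨n, f, ⟨-, hf0, hfn, -, hadj⟩, hconn⟩ := h
  have key : ∀ t ≤ n, ∃ m a, Reach E C K i m (f t) a ∧
      (a = true → 0 < t ∧ E (f (t - 1)) (f t)) ∧ (a = false → 0 < t → E (f t) (f (t - 1))) := by
    intro t
    induction t with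
    | zero => exact fun _ => ⟨0, false, hf0 ▸ .start, by simp, by simp⟩
    | succ t ih =>
      intro ht
      obtain ⟨m, a, hr, ha, ha'⟩ := ih (by omega)
      have hnc : ¬ ColliderAt E f t → f t ∉ C := by
        intro hc
        rcases Nat.eq_zero_or_pos t with rfl | hpos
        · rwa [hf0]
        · exact (hconn t hpos ht).2 hc
      rcases hadj t ht with he | he
      · exact ⟨m + 1, true, hr.step (.inl ⟨rfl, he, hnc fun hc => hE _ _ he hc.2, rfl⟩),
          by simpa using he, by simp⟩
      · cases a with
        | true =>
          obtain ⟨hpos, he'⟩ := ha rfl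
          refine ⟨m + K, false, hr.step (.inr (.inr ⟨rfl, rfl, he, ?_, rfl⟩)), by simp,
            fun _ _ => by simpa using he⟩
          rcases (hconn t hpos ht).1 ⟨he', he⟩ with h | h
          · exact ⟨_, h, .refl⟩
          · exact h
        | false =>
          refine ⟨m + 1, false, hr.step (.inr (.inl ⟨rfl, rfl, he, ?_, rfl⟩)), by simp,
            fun _ _ => by simpa using he⟩
          rcases Nat.eq_zero_or_pos t with rfl | hpos
          · rwa [hf0]
          · exact hnc fun hc => hE _ _ (ha' rfl hpos) hc.1
  obtain ⟨m, a, hr, -⟩ := key n le_rfl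
  exact ⟨m, a, hfn ▸ hr⟩

theorem exists_height [Fintype V] {E : V → V → Prop} (hE : Acyclic E) :
    ∃ h : V → ℕ, ∀ a b, E a b → h a < h b := by
  classical
  refine ⟨fun v => (Finset.univ.filter fun u => Relation.TransGen E u v).card, fun a b hab => ?_⟩
  apply Finset.card_lt_card
  rw [Finset.ssubset_iff_of_subset]
  · exact ⟨a, by simpa using .single hab, by simpa using hE a⟩
  · intro u hu
    simp only [Finset.mem_filter, Finset.mem_univ, true_and] at hu ⊢
    exact hu.tail hab

/-- A directed path all of whose vertices, except possibly the last one, avoid `C`. -/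
def Chain (E : V → V → Prop) (C : Finset V) : V → V → Prop :=
  Relation.ReflTransGen fun a b => E a b ∧ a ∉ C

section Chain

variable {E : V → V → Prop} {C : Finset V} {K : ℕ} {i : V} {h : V → ℕ}

theorem Chain.height_le (hh : ∀ a b, E a b → h a < h b) {k m : V} (hc : Chain E C k m) :
    h k ≤ h m := by
  induction hc with
  | refl => rfl
  | tail _ he ih => exact ih.trans (hh _ _ he.1).le

theorem Chain.reach_down (hh : ∀ a b, E a b → h a < h b) {k m : V} (hc : Chain E C k m) {n : ℕ}
    (hr : Reach E C K i n k true) :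
    ∃ n', Reach E C K i n' m true ∧ n' + h k ≤ n + h m := by
  induction hc with
  | refl => exact ⟨n, hr, le_rfl⟩
  | @tail u w _ he ih =>
    obtain ⟨n', hr', hn'⟩ := ih
    refine ⟨n' + 1, hr'.step (.inl ⟨rfl, he.1, he.2, rfl⟩), ?_⟩
    have := hh _ _ he.1
    omega

theorem Chain.reach_up (hh : ∀ a b, E a b → h a < h b) {k m : V} (hc : Chain E C k m)
    (hm : m ∉ C) {n : ℕ} (hr : Reach E C K i n m false) :
    ∃ n', Reach E C K i n' k false ∧ n' + h k ≤ n + h m := by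
  induction hc generalizing n with
  | refl => exact ⟨n, hr, le_rfl⟩
  | @tail u w _ he ih =>
    obtain ⟨n', hr', hn'⟩ := ih he.2 (hr.step (.inr (.inl ⟨rfl, rfl, he.1, hm, rfl⟩)))
    refine ⟨n', hr', ?_⟩
    have := hh _ _ he.1
    omega

end Chain

/-- The walk passes a collider at time `t`. -/
def TurnAt (N : ℕ) (b : ℕ → Bool) (t : ℕ) : Prop :=
  t < N ∧ b t = true ∧ b (t + 1) = false

namespace CheapestWalk

variable {E : V → V → Prop} {C : Finset V} {K : ℕ} {i j : V} {N : ℕ}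
  {v : ℕ → V} {b : ℕ → Bool} {d : ℕ → ℕ} {h : V → ℕ}

theorem down (w : CheapestWalk E C K i j N v b d) {t : ℕ} (ht : t < N) (hb : b (t + 1) = true) :
    E (v t) (v (t + 1)) ∧ v t ∉ C ∧ d (t + 1) = d t + 1 := by
  obtain ⟨c, h | h | h, hd⟩ := w.step t ht
  · obtain ⟨-, h1, h2, rfl⟩ := h
    exact ⟨h1, h2, hd⟩
  · simp [hb] at h
  · simp [hb] at h

theorem up (w : CheapestWalk E C K i j N v b d) {t : ℕ} (ht : t < N) (hb : b t = false)
    (hb' : b (t + 1) = false) :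
    E (v (t + 1)) (v t) ∧ v t ∉ C ∧ d (t + 1) = d t + 1 := by
  obtain ⟨c, h | h | h, hd⟩ := w.step t ht
  · simp [hb'] at h
  · obtain ⟨-, -, h1, h2, rfl⟩ := h
    exact ⟨h1, h2, hd⟩
  · simp [hb] at h

theorem turn (w : CheapestWalk E C K i j N v b d) {t : ℕ} (ht : TurnAt N b t) :
    E (v (t + 1)) (v t) ∧ (∃ z ∈ C, Desc E (v t) z) ∧ d (t + 1) = d t + K := by
  obtain ⟨ht, hb, hb'⟩ := ht
  obtain ⟨c, h | h | h, hd⟩ := w.step t ht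
  · simp [hb'] at h
  · simp [hb] at h
  · obtain ⟨-, -, h1, h2, rfl⟩ := h
    exact ⟨h1, h2, hd⟩

theorem not_mem_of_not_turnAt (w : CheapestWalk E C K i j N v b d) (hj : j ∉ C) {t : ℕ}
    (ht : t ≤ N) (hn : ¬ TurnAt N b t) : v t ∉ C := by
  rcases ht.eq_or_lt with rfl | ht
  · rwa [w.v_last]
  · cases hb' : b (t + 1) with
    | true => exact (w.down ht hb').2.1
    | false =>
      cases hb : b t with
      | true => exact absurd ⟨ht, hb, hb'⟩ hn
      | false => exact (w.up ht hb hb').2.1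

theorem cost_add_one_le (w : CheapestWalk E C K i j N v b d) (hK : 0 < K) {t : ℕ} (ht : t < N) :
    d t + 1 ≤ d (t + 1) := by
  obtain ⟨c, h | h | h, hd⟩ := w.step t ht <;> omega

theorem cost_mono (w : CheapestWalk E C K i j N v b d) (hK : 0 < K) {s t : ℕ} (hst : s ≤ t)
    (ht : t ≤ N) : d s ≤ d t := by
  induction t, hst using Nat.le_induction with
  | base => rfl
  | succ t _ ih =>
    have := w.cost_add_one_le hK ht
    have := ih (by omega)
    omega

/-- The walk gains height only by entering a vertex from a parent, or after passing a
collider. -/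
theorem cost_or_height_of_up (w : CheapestWalk E C K i j N v b d) (hK : 0 < K)
    (hh : ∀ a b, E a b → h a < h b) {s t : ℕ} (hst : s ≤ t) (ht : t ≤ N) :
    d s + K ≤ d t ∨ b t = true ∨ h (v t) ≤ h (v s) := by
  induction t, hst using Nat.le_induction with
  | base => simp
  | succ t _ ih =>
    have h1 := w.cost_add_one_le hK ht
    cases hb' : b (t + 1) with
    | true => simp
    | false =>
      cases hb : b t with
      | true =>
        have := (w.turn ⟨ht, hb, hb'⟩).2.2
        have := w.cost_mono hK ‹s ≤ t› (by omega)
        left; omega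
      | false =>
        have := hh _ _ (w.up ht hb hb').1
        have := ih (by omega)
        simp only [hb, Bool.false_eq_true, false_or] at this ⊢
        omega

/-- After a downward move, the walk keeps descending until it passes a collider. -/
theorem cost_or_height_of_down (w : CheapestWalk E C K i j N v b d) (hK : 0 < K)
    (hh : ∀ a b, E a b → h a < h b) {s t : ℕ} (hb : b s = true) (hst : s ≤ t) (ht : t ≤ N) :
    d s + K ≤ d t ∨ (b t = true ∧ h (v s) ≤ h (v t)) := by
  induction t, hst using Nat.le_induction with
  | base => simp [hb]
  | succ t _ ih =>
    have h1 := w.cost_add_one_le hK ht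
    rcases ih (by omega) with ih | ⟨hbt, ih⟩
    · left; omega
    · cases hb' : b (t + 1) with
      | true =>
        have := hh _ _ (w.down ht hb').1
        right
        exact ⟨rfl, by omega⟩
      | false =>
        have := (w.turn ⟨ht, hbt, hb'⟩).2.2
        have := w.cost_mono hK ‹s ≤ t› (by omega)
        left; omega

/-- No vertex is both entered from a parent and left towards a child, and, at another time,
entered from a child and left towards a parent. -/
theorem not_down_and_up (w : CheapestWalk E C K i j N v b d) (hK : 0 < K)
    (hh : ∀ a b, E a b → h a < h b)
    {s t : ℕ} (hs : s ≤ N) (hbs : b s = true) (hsn : ¬ TurnAt N b s)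
    (ht : t < N) (hbt : b t = false) (hbt' : b (t + 1) = false) : v s ≠ v t := by
  intro hst
  have hdt := w.up ht hbt hbt'
  rcases lt_trichotomy s t with hlt | rfl | hlt
  · have hbs' : b (s + 1) = true := by
      by_contra hf
      exact hsn ⟨by omega, hbs, by simpa using hf⟩
    have hds := w.down (by omega) hbs'
    rcases w.cost_or_height_of_down hK hh hbs' (Nat.add_one_le_iff.mpr hlt) ht.le with h1 | h1
    · have hr := w.reach s hs
      rw [hst, hbs] at hr
      by_cases hz : ∃ z ∈ C, Desc E (v t) z
      · have := hr.step (.inr (.inr ⟨rfl, rfl, hdt.1, hz, rfl⟩))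
        rw [← hbt'] at this
        have := w.le_of_reach (t + 1) ht _ this
        omega
      · have hex : ∀ r, s + 1 ≤ r → r ≤ t → b r = true ∧ Desc E (v s) (v r) := by
          intro r hr
          induction r, hr using Nat.le_induction with
          | base => exact fun _ => ⟨hbs', .single hds.1⟩
          | succ r _ ih =>
            intro hrt
            obtain ⟨hb1, hd1⟩ := ih (by omega)
            cases hb' : b (r + 1) with
            | true => exact ⟨rfl, hd1.tail (w.down (by omega) hb').1⟩
            | false =>
              obtain ⟨-, ⟨z, hz1, hz2⟩, -⟩ := w.turn ⟨by omega, hb1, hb'⟩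
              exact absurd ⟨z, hz1, hst ▸ hd1.trans hz2⟩ hz
        simp [(hex t hlt le_rfl).1] at hbt
    · simp [h1.1] at hbt
  · simp [hbs] at hbt
  · have hr := w.reach t ht.le
    have hlt' := w.cost_mono hK (Nat.add_one_le_iff.mpr hlt) hs
    rw [← hst] at hr
    rcases hs.eq_or_lt with rfl | hs
    · have := w.last_le_of_reach _ _ (w.v_last ▸ hr)
      omega
    · have hbs' : b (s + 1) = true := by
        by_contra hf
        exact hsn ⟨hs, hbs, by simpa using hf⟩
      have hds := w.down hs hbs'
      have := hr.step (.inl ⟨rfl, hds.1, hds.2.1, rfl⟩)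
      rw [← hbs'] at this
      have := w.le_of_reach (s + 1) hs _ this
      omega

/-- A directed path from a collider of a cheapest walk to `C` meets no non-collider of
the walk. -/
theorem ne_of_chain (w : CheapestWalk E C K i j N v b d) (hj : j ∉ C)
    (hh : ∀ a b, E a b → h a < h b) (hM : ∀ a, h a < K)
    {s t : ℕ} (hs : s ≤ N) (hsn : ¬ TurnAt N b s) (ht : TurnAt N b t) {m : V}
    (hc : Chain E C (v t) m) (hm : ∃ z ∈ C, Desc E m z) : m ≠ v s := by
  rintro rfl
  have hK : 0 < K := (Nat.zero_le _).trans_lt (hM i)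
  have hsC := w.not_mem_of_not_turnAt hj hs hsn
  have hdt := w.turn ht
  have hkm := hc.height_le hh
  have hMs := hM (v s)
  rcases lt_trichotomy t s with hlt | rfl | hlt
  · have hr := w.reach t (by omega)
    rw [ht.2.1] at hr
    obtain ⟨n, hn, hle⟩ := hc.reach_down hh hr
    have hdts := w.cost_mono hK (Nat.add_one_le_iff.mpr hlt) hs
    cases hbs : b s with
    | true =>
      rw [← hbs] at hn
      have := w.le_of_reach _ hs _ hn
      omega
    | false =>
      rcases hs.eq_or_lt with rfl | hs'
      · have := w.last_le_of_reach _ _ (w.v_last ▸ hn)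
        omega
      · cases hbs' : b (s + 1) with
        | true =>
          obtain ⟨h1, h2, h3⟩ := w.down hs' hbs'
          have := hn.step (.inl ⟨rfl, h1, h2, rfl⟩)
          rw [← hbs'] at this
          have := w.le_of_reach (s + 1) hs' _ this
          omega
        | false =>
          obtain ⟨h1, h2, h3⟩ := w.up hs' hbs hbs'
          have := hn.step (.inr (.inr ⟨rfl, rfl, h1, hm, rfl⟩))
          rw [← hbs'] at this
          have := w.le_of_reach (s + 1) hs' _ this
          have h4 := hh _ _ hdt.1
          rcases w.cost_or_height_of_up hK hh (Nat.add_one_le_iff.mpr hlt) hs with h5 | h5 | h5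
          · omega
          · simp [hbs] at h5
          · omega
  · exact hsn ht
  · have hr := w.reach s hs
    have hkC : v t ∉ C := by
      rcases Relation.ReflTransGen.cases_head hc with h | ⟨_, h, -⟩
      · rwa [h]
      · exact h.2
    have hdst := w.cost_mono hK (Nat.add_one_le_iff.mpr hlt) ht.1.le
    have hlast : ∀ n, Reach E C K i n (v t) false → d t + K ≤ n + 1 := by
      intro n hn
      have := hn.step (.inr (.inl ⟨rfl, rfl, hdt.1, hkC, rfl⟩))
      rw [← ht.2.2] at this
      have := w.le_of_reach (t + 1) ht.1 _ this
      omega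
    have hlt1 := w.cost_add_one_le hK (hlt.trans ht.1)
    cases hbs : b s with
    | false =>
      rw [hbs] at hr
      obtain ⟨n, hn, hle⟩ := hc.reach_up hh hsC hr
      have := hlast n hn
      omega
    | true =>
      have hbs' : b (s + 1) = true := by
        by_contra hf
        exact hsn ⟨hlt.trans ht.1, hbs, by simpa using hf⟩
      have hds := hh _ _ (w.down (hlt.trans ht.1) hbs').1
      rw [hbs] at hr
      rcases w.cost_or_height_of_down hK hh hbs' (Nat.add_one_le_iff.mpr hlt) ht.1.le with h1 | h1
      · rcases Relation.ReflTransGen.cases_tail hc with h2 | ⟨u, hu, hus, huC⟩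
        · have := w.le_of_reach t ht.1.le (d s) (by rw [ht.2.1, ← h2]; exact hr)
          omega
        · have hr' := hr.step (.inr (.inr ⟨rfl, rfl, hus, hm, rfl⟩))
          obtain ⟨n, hn, hle⟩ := Chain.reach_up hh hu huC hr'
          have := hlast n hn
          have := hM u
          omega
      · omega

end CheapestWalk

section Network

/-- The kernel on `{0,1}` that puts all mass on `1` if `A` holds, all mass on `0` if `A` fails
and `B` holds, and is uniform otherwise. -/
noncomputable def forcedKernel (A B : Prop) (a : Bool) : ℝ :=
  open Classical in
  if A then (if a then 1 else 0) else if B then (if a then 0 else 1) else 1 / 2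

theorem forcedKernel_nonneg (A B : Prop) (a : Bool) : 0 ≤ forcedKernel A B a := by
  unfold forcedKernel
  split_ifs <;> norm_num

theorem sum_forcedKernel (A B : Prop) : ∑ a : Bool, forcedKernel A B a = 1 := by
  simp only [Fintype.sum_bool, forcedKernel]
  split_ifs <;> norm_num at *

theorem forcedKernel_pos_iff (A B : Prop) (a : Bool) :
    0 < forcedKernel A B a ↔ (A → a = true) ∧ (¬ A → B → a = false) := by
  unfold forcedKernel
  cases a <;> by_cases A <;> by_cases B <;> simp_all

/-- The total mass of a product of normalized kernels along a DAG. -/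
theorem sum_prod_kernel {p : ℕ} {E : Fin p → Fin p → Prop} {h : Fin p → ℕ}
    (hh : ∀ a b, E a b → h a < h b) (φ : Fin p → (Fin p → Bool) → ℝ)
    (hloc : ∀ i x y, x i = y i → (∀ k, E k i → x k = y k) → φ i x = φ i y)
    (hsum : ∀ i x, ∑ a, φ i (Function.update x i a) = 1) (T : Finset (Fin p)) :
    (∑ x, ∏ i ∈ T, φ i x) * 2 ^ T.card = 2 ^ p := by
  classical
  induction T using Finset.induction_on_max_value h with
  | empty => simp
  | insert m T hm hmax ih =>
    let e : Equiv.Perm (Fin p → Bool) :=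
      Function.Involutive.toPerm (fun x => Function.update x m (!x m)) fun x => by simp
    have he : ∀ x, e x = Function.update x m (!x m) := fun _ => rfl
    have hinv : ∀ x, ∏ i ∈ T, φ i (e x) = ∏ i ∈ T, φ i x := by
      intro x
      refine Finset.prod_congr rfl fun i hi => hloc i _ _ ?_ fun k hk => ?_
      · rw [he, Function.update_of_ne (by rintro rfl; exact hm hi)]
      · rw [he, Function.update_of_ne]
        rintro rfl
        exact (hmax i hi).not_gt (hh _ _ hk)
    have hone : ∀ x, φ m x + φ m (e x) = 1 := by
      intro x
      rw [← hsum m x, Fintype.sum_bool, he]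
      have hx : φ m x = φ m (Function.update x m (x m)) := by rw [Function.update_eq_self]
      rw [hx]
      cases x m
      · simp [add_comm]
      · simp
    have hflip : ∑ x, φ m x * ∏ i ∈ T, φ i x = ∑ x, φ m (e x) * ∏ i ∈ T, φ i x := by
      rw [← Equiv.sum_comp e]
      simp only [hinv]
    have htwo : 2 * ∑ x, φ m x * ∏ i ∈ T, φ i x = ∑ x, ∏ i ∈ T, φ i x := by
      rw [two_mul]
      nth_rewrite 2 [hflip]
      rw [← Finset.sum_add_distrib]
      exact Finset.sum_congr rfl fun x _ => by rw [← add_mul, hone, one_mul]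
    simp only [Finset.prod_insert hm]
    rw [Finset.card_insert_of_notMem hm, ← ih, ← htwo]
    ring

/-- A network in which every value is forced or uniform, given by conditions on the parents. -/
theorem exists_network {p : ℕ} {E : Fin p → Fin p → Prop} {h : Fin p → ℕ}
    (hh : ∀ a b, E a b → h a < h b) (A B : Fin p → (Fin p → Bool) → Prop)
    (hA : ∀ i x y, (∀ k, E k i → x k = y k) → A i x → A i y)
    (hB : ∀ i x y, (∀ k, E k i → x k = y k) → B i x → B i y) :
    ∃ P : (Fin p → Bool) → ℝ, IsPMF P ∧ Factorizes (𝒳 := fun _ => Bool) E P ∧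
      ∀ x, 0 < P x ↔ ∀ i, (A i x → x i = true) ∧ (¬ A i x → B i x → x i = false) := by
  have hA' : ∀ i x y, (∀ k, E k i → x k = y k) → A i x = A i y := fun i x y hxy =>
    propext ⟨hA i x y hxy, hA i y x fun k hk => (hxy k hk).symm⟩
  have hB' : ∀ i x y, (∀ k, E k i → x k = y k) → B i x = B i y := fun i x y hxy =>
    propext ⟨hB i x y hxy, hB i y x fun k hk => (hxy k hk).symm⟩
  let φ : Fin p → (Fin p → Bool) → ℝ := fun i x => forcedKernel (A i x) (B i x) (x i)
  have hnn : ∀ i x, 0 ≤ φ i x := fun i x => forcedKernel_nonneg _ _ _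
  have hloc : ∀ i x y, x i = y i → (∀ k, E k i → x k = y k) → φ i x = φ i y := by
    intro i x y hi hxy
    simp only [φ, hA' i x y hxy, hB' i x y hxy, hi]
  have hsum : ∀ i x, ∑ a, φ i (Function.update x i a) = 1 := by
    intro i x
    rw [← sum_forcedKernel (A i x) (B i x)]
    refine Finset.sum_congr rfl fun a _ => ?_
    have hx : ∀ k, E k i → Function.update x i a k = x k := fun k hk =>
      Function.update_of_ne (by rintro rfl; exact lt_irrefl _ (hh _ _ hk)) _ _
    simp only [φ, hA' i _ x hx, hB' i _ x hx, Function.update_self]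
  refine ⟨fun x => ∏ i, φ i x, ⟨fun x => Finset.prod_nonneg fun i _ => hnn i x, ?_⟩,
    ⟨φ, hnn, hloc, hsum, fun _ => rfl⟩, fun x => ?_⟩
  · have := sum_prod_kernel hh φ hloc hsum Finset.univ
    rw [Finset.card_univ, Fintype.card_fin] at this
    exact mul_right_cancel₀ (pow_ne_zero p two_ne_zero) (this.trans (one_mul _).symm)
  · simp only [← forcedKernel_pos_iff]
    constructor
    · intro hpos i
      refine (hnn i x).lt_of_ne fun h0 => hpos.ne ?_
      exact (Finset.prod_eq_zero (Finset.mem_univ i) h0.symm).symm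
    · exact fun hpos => Finset.prod_pos fun i _ => hpos i

/-- A pmf whose support makes `x i` a nontrivial function of `x j` and `x C` near `x` violates
conditional independence. -/
theorem not_condIndep_of_support {p : ℕ} {P : (Fin p → Bool) → ℝ} (hP : ∀ x, 0 ≤ P x)
    {i j : Fin p} {C : Finset (Fin p)} {x y : Fin p → Bool} (hx : 0 < P x)
    (hdet : ∀ z, 0 < P z → z j = x j → (∀ k ∈ C, z k = x k) → z i = x i)
    (hy : 0 < P y) (hyC : ∀ k ∈ C, y k = x k) (hyi : y i ≠ x i) :
    ¬ CondIndep (𝒳 := fun _ => Bool) P {i} {j} C := by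
  classical
  intro hci
  have hci := hci x
  have heq : margin (𝒳 := fun _ => Bool) P ({i} ∪ {j} ∪ C) x =
      margin (𝒳 := fun _ => Bool) P ({j} ∪ C) x := by
    refine Finset.sum_congr rfl fun z _ => ?_
    rcases (hP z).eq_or_lt with hz | hz
    · simp [← hz]
    · have hiff : (∀ k ∈ {i} ∪ {j} ∪ C, z k = x k) ↔ ∀ k ∈ {j} ∪ C, z k = x k := by
        simp only [Finset.mem_union, Finset.mem_singleton]
        refine ⟨fun hk k hkm => hk k (by tauto), fun hk k hkm => ?_⟩
        rcases hkm with (rfl | hkm) | hkm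
        · exact hdet z hz (hk j (.inl rfl)) fun l hl => hk l (.inr hl)
        · exact hk k (.inl hkm)
        · exact hk k (.inr hkm)
      by_cases hk : ∀ k ∈ {j} ∪ C, z k = x k
      · rw [if_pos hk, if_pos (hiff.2 hk)]
      · rw [if_neg hk, if_neg (mt hiff.1 hk)]
  have hpos : 0 < margin (𝒳 := fun _ => Bool) P ({j} ∪ C) x := by
    refine Finset.sum_pos' (fun z _ => ?_) ⟨x, Finset.mem_univ _, by simpa using hx⟩
    split_ifs
    exacts [hP z, le_rfl]
  have hlt : margin (𝒳 := fun _ => Bool) P ({i} ∪ C) x < margin (𝒳 := fun _ => Bool) P C x := by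
    refine Finset.sum_lt_sum (fun z _ => ?_) ⟨y, Finset.mem_univ _, ?_⟩
    · split_ifs with h1 h2
      · exact le_rfl
      · exact absurd (fun k hk => h1 k (Finset.mem_union_right _ hk)) h2
      · exact hP z
      · exact le_rfl
    · rw [if_neg fun h1 => hyi (h1 i (by simp)), if_pos hyC]
      exact hy
  rw [heq, mul_comm] at hci
  exact hlt.ne' (mul_right_cancel₀ hpos.ne' hci)

end Network

/-- **Completeness of d-separation.** If `i` and `j` are d-connected given `C` in a
DAG `G` on `Fin p`, then there is a pmf `P` on `{0,1}^p` that factorizes according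
to `G` and under which `X_i` and `X_j` are not conditionally independent given
`X_C`. -/
theorem dsep_complete {p : ℕ} (G : Fin p → Fin p → Prop) (hG : Acyclic G)
    (i j : Fin p) (C : Finset (Fin p)) (hij : i ≠ j) (hiC : i ∉ C) (hjC : j ∉ C)
    (hconn : ¬ DSep G i j C) :
    ∃ P : (Fin p → Bool) → ℝ,
      IsPMF P ∧ Factorizes (𝒳 := fun _ => Bool) G P ∧
        ¬ CondIndep (𝒳 := fun _ => Bool) P {i} {j} C := by
  classical
  obtain ⟨h, hh⟩ := exists_height hG
  obtain ⟨K, hK⟩ : ∃ K, ∀ a, h a < K :=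
    ⟨Finset.univ.sup h + 1, fun a => Nat.lt_succ_of_le (Finset.le_sup (Finset.mem_univ a))⟩
  have hK0 : 0 < K := (Nat.zero_le _).trans_lt (hK i)
  obtain ⟨N, v, b, d, w⟩ := exists_cheapestWalk
    (exists_reach_of_not_dsep K (fun a b h1 h2 => (hh _ _ h1).not_gt (hh _ _ h2)) hiC hconn)
  let S : Set (Fin p) := {u | ∃ t ≤ N, v t = u ∧ ¬ TurnAt N b t}
  -- Vertices of `S` propagate the value `1` along the walk; the others are `1` only to
  -- signal that this propagation fails at a collider.
  let A : Fin p → (Fin p → Bool) → Prop := fun u x =>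
    (u ∈ S ∧ ∃ t < N, v (t + 1) = u ∧ b (t + 1) = true ∧ ¬ TurnAt N b (t + 1) ∧
      x (v t) = true) ∨
    (u ∉ S ∧ ((∃ t, TurnAt N b (t + 1) ∧ v (t + 1) = u ∧ x (v t) = true ∧
      x (v (t + 1 + 1)) = false) ∨ ∃ k ∉ S, G k u ∧ x k = true))
  let B : Fin p → (Fin p → Bool) → Prop := fun u x =>
    u ∉ S ∨ ∃ t < N, v t = u ∧ b t = false ∧ b (t + 1) = false ∧ x (v (t + 1)) = false
  have hA : ∀ u x y, (∀ k, G k u → x k = y k) → A u x → A u y := by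
    rintro u x y hxy (⟨hu, t, ht, rfl, hb, hn, hx⟩ | ⟨hu, ⟨t, ht, rfl, hx, hx'⟩ | ⟨k, hk, he, hx⟩⟩)
    · exact .inl ⟨hu, t, ht, rfl, hb, hn, hxy _ (w.down ht hb).1 ▸ hx⟩
    · have ht' : t + 1 < N := ht.1
      exact .inr ⟨hu, .inl ⟨t, ht, rfl, hxy _ (w.down (by omega) ht.2.1).1 ▸ hx,
        hxy _ (w.turn ht).1 ▸ hx'⟩⟩
    · exact .inr ⟨hu, .inr ⟨k, hk, he, hxy k he ▸ hx⟩⟩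
  have hB : ∀ u x y, (∀ k, G k u → x k = y k) → B u x → B u y := by
    rintro u x y hxy (hu | ⟨t, ht, rfl, hb, hb', hx⟩)
    · exact .inl hu
    · exact .inr ⟨t, ht, rfl, hb, hb', hxy _ (w.up ht hb hb').1 ▸ hx⟩
  have memS : ∀ t < N, b (t + 1) = false → v (t + 1) ∈ S := fun t ht hb =>
    ⟨t + 1, ht, rfl, fun hT => by simp [hT.2.1] at hb⟩
  obtain ⟨P, hpmf, hfac, hsupp⟩ := exists_network hh A B hA hB
  refine ⟨P, hpmf, hfac, not_condIndep_of_support (x := fun _ => false)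
    (y := fun u => decide (u ∈ S)) hpmf.1 ?_ ?_ ?_ ?_ ?_⟩
  · rw [hsupp]
    refine fun u => ⟨?_, fun _ _ => rfl⟩
    rintro (⟨-, t, ht, hv, hb, hT, hx⟩ | ⟨-, ⟨t, hT, hv, hx, hx'⟩ | ⟨k, hk, he, hx⟩⟩) <;>
      simp at hx
  · intro y hy hyj hyC
    rw [hsupp] at hy
    by_contra hyi
    have noflag : ∀ t, TurnAt N b t → ∀ u, ∀ z ∈ C, Desc G u z → Chain G C (v t) u →
        y u = false := by
      intro t ht u z hz huz
      induction huz using Relation.ReflTransGen.head_induction_on with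
      | refl => exact fun _ => hyC z hz
      | @head u u' he hd ih =>
        intro hc
        by_cases huC : u ∈ C
        · exact hyC u huC
        have hc' : Chain G C (v t) u' := hc.tail ⟨he, huC⟩
        have hnS : ∀ m, Desc G m z → Chain G C (v t) m → m ∉ S := by
          rintro m hm hcm ⟨s, hs, rfl, hsn⟩
          exact w.ne_of_chain hjC hh hK hs hsn ht hcm ⟨z, hz, hm⟩ rfl
        by_contra hyu
        have := (hy u').1 (.inr ⟨hnS u' hd hc',
          .inr ⟨u, hnS u (.head he hd) hc, he, by simpa using hyu⟩⟩)
        rw [ih hc'] at this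
        exact Bool.false_ne_true this
    have key : ∀ t ≤ N, (¬ TurnAt N b t → y (v t) = true) ∧
        (TurnAt N b t → ∃ r, t = r + 1 ∧ y (v r) = true) := by
      intro t
      induction t with
      | zero =>
        refine fun _ => ⟨fun _ => by simpa [w.v_zero] using hyi, fun hT => ?_⟩
        simp [w.b_zero, TurnAt] at hT
      | succ t ih =>
        intro ht
        obtain ⟨ih1, ih2⟩ := ih (by omega)
        have hdown : b (t + 1) = true → y (v t) = true := fun hb =>
          ih1 fun hT => by simp [hT.2.2] at hb
        refine ⟨fun hT => ?_, fun hT => ⟨t, rfl, hdown hT.2.1⟩⟩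
        cases hb' : b (t + 1) with
        | true =>
          exact (hy _).1 (.inl ⟨⟨t + 1, ht, rfl, hT⟩, t, ht, rfl, hb', hT, hdown hb'⟩)
        | false =>
          by_contra hyt
          have hyt : y (v (t + 1)) = false := by simpa using hyt
          cases hb : b t with
          | false =>
            have hTt : ¬ TurnAt N b t := fun hT => by simp [hT.2.1] at hb
            have hmem : v t ∈ S := ⟨t, by omega, rfl, hTt⟩
            have hnA : ¬ A (v t) y := by
              rintro (⟨-, s, hs, hvs, hbs, hTs, -⟩ | ⟨hn, -⟩)
              · exact w.not_down_and_up hK0 hh hs hbs hTs ht hb hb' hvs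
              · exact hn hmem
            have := (hy (v t)).2 hnA (.inr ⟨t, ht, rfl, hb, hb', hyt⟩)
            simp [ih1 hTt] at this
          | true =>
            have hTt : TurnAt N b t := ⟨ht, hb, hb'⟩
            obtain ⟨r, rfl, hr⟩ := ih2 hTt
            obtain ⟨-, ⟨z, hz, hd⟩, -⟩ := w.turn hTt
            have hnS : v (r + 1) ∉ S := by
              rintro ⟨s, hs, hvs, hsn⟩
              exact w.ne_of_chain hjC hh hK hs hsn hTt .refl ⟨z, hz, hd⟩ hvs.symm
            have := (hy _).1 (.inr ⟨hnS, .inl ⟨r, hTt, rfl, hr, hyt⟩⟩)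
            simp [noflag _ hTt _ z hz hd .refl] at this
    have := (key N le_rfl).1 fun hT => lt_irrefl _ hT.1
    rw [w.v_last, hyj] at this
    exact Bool.false_ne_true this
  · rw [hsupp]
    refine fun u => ⟨?_, fun hnA hBu => ?_⟩
    · rintro (⟨hu, -⟩ | ⟨-, ⟨t, hT, -, -, hx⟩ | ⟨k, hk, -, hx⟩⟩)
      · simpa using hu
      · simp [memS _ hT.1 hT.2.2] at hx
      · simp [hk] at hx
    · rcases hBu with hu | ⟨t, ht, -, -, hb', hx⟩
      · simpa using hu
      · simp [memS _ ht hb'] at hx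
  · rintro k hk
    have : k ∉ S := by
      rintro ⟨t, ht, rfl, hT⟩
      exact w.not_mem_of_not_turnAt hjC ht hT hk
    simpa using this
  · have : i ∈ S := ⟨0, Nat.zero_le _, w.v_zero, fun hT => by simp [w.b_zero, TurnAt] at hT⟩
    simp [this]

end CausalDiscovery
end
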